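/- arXiv:1802.01057 — 2 statements merged into one kernel-verified Lean document; each statement's English description precedes it below -/
import Mathlib

section
/- Let n ≥ 1, p ≥ 1, s ≥ 0, 0 < α ≤ n and C > 0. Suppose that for every Schwartz function f on ℝⁿ and every finite Borel measure μ on ℝⁿ supported in B(0,1) with [μ]_α < ∞ one has (∫₀¹ ∫_{ℝⁿ} |e^{it√(−Δ)}f(x)|^p dμ(x) dt)^{1/p} ≤ C [μ]_α^{1/p} ‖f‖_{H^s}. Then for every s' > s + 1/p there is a constant C' > 0 such that for all such f and μ one has (∫_{ℝⁿ} sup_{t ∈ [0,1]} |e^{it√(−Δ)}f(x)|^p dμ(x))^{1/p} ≤ C' [μ]_α^{1/p} ‖f‖_{H^{s'}}. -/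
open MeasureTheory Real Metric
open scoped ENNReal RealInnerProductSpace

noncomputable section

abbrev E (n : ℕ) : Type := EuclideanSpace ℝ (Fin n)

/-- The Frostman constant `[μ]_α = sup_{x,r>0} μ(B(x,r))/r^α`. -/
def frostman {d : ℕ} (μ : Measure (E d)) (α : ℝ) : ℝ≥0∞ :=
  ⨆ (x : E d) (r : ℝ) (_ : 0 < r), μ (Metric.ball x r) / ENNReal.ofReal (r ^ α)

/-- The Fourier transform `f̂(ξ) = ∫ e^{-2πi x·ξ} f(x) dx`. -/
def FT {n : ℕ} (f : E n → ℂ) (ξ : E n) : ℂ :=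
  ∫ x, Complex.exp (((-2 * π * ⟪x, ξ⟫ : ℝ) : ℂ) * Complex.I) * f x

/-- The Sobolev norm `‖f‖_{H^s} = (∫ (1+|ξ|²)^s |f̂(ξ)|² dξ)^{1/2}`. -/
def sobolevNorm {n : ℕ} (f : E n → ℂ) (s : ℝ) : ℝ :=
  (∫ ξ : E n, (1 + ‖ξ‖ ^ 2) ^ s * ‖FT f ξ‖ ^ 2) ^ (1/2 : ℝ)

/-- The half-wave propagator `e^{it√(-Δ)}f(x) = ∫ e^{2πi(x·ξ+t|ξ|)} f̂(ξ) dξ`. -/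
def halfWave {n : ℕ} (f : E n → ℂ) (t : ℝ) (x : E n) : ℂ :=
  ∫ ξ : E n, Complex.exp (((2 * π * (⟪x, ξ⟫ + t * ‖ξ‖) : ℝ) : ℂ) * Complex.I) * FT f ξ

/-- The Fourier-side half-wave integral `∫ e^{2πi(x·ξ+t|ξ|)} G(ξ) dξ`. -/
def wave {n : ℕ} (G : E n → ℂ) (t : ℝ) (x : E n) : ℂ :=
  ∫ ξ : E n, Complex.exp (((2 * π * (⟪x, ξ⟫ + t * ‖ξ‖) : ℝ) : ℂ) * Complex.I) * G ξ

/-- The maximal function `sup_{t ∈ [0,1]} |∫ e^{2πi(x·ξ+t|ξ|)} G(ξ) dξ|`. -/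
def waveSup {n : ℕ} (G : E n → ℂ) (x : E n) : ℝ≥0∞ :=
  ⨆ t : Set.Icc (0:ℝ) 1, ‖wave G t x‖ₑ

/-- The weighted `L²` norm `(∫ (1+|ξ|²)^s |G(ξ)|² dξ)^{1/2}` with values in `[0, ∞]`. -/
def weightedNorm {n : ℕ} (s : ℝ) (G : E n → ℂ) : ℝ≥0∞ :=
  (∫⁻ ξ : E n, ENNReal.ofReal ((1 + ‖ξ‖ ^ 2) ^ s) * ‖G ξ‖ₑ ^ 2) ^ (1/2 : ℝ)

theorem enorm_wave_le {n : ℕ} (G : E n → ℂ) (t : ℝ) (x : E n) :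
    ‖wave G t x‖ₑ ≤ ∫⁻ ξ, ‖G ξ‖ₑ := by
  refine (enorm_integral_le_lintegral_enorm _).trans (lintegral_mono fun ξ => ?_)
  rw [enorm_mul, ← ofReal_norm, Complex.norm_exp_ofReal_mul_I]
  simp

theorem continuous_wave {n : ℕ} {G : E n → ℂ} (hG : Integrable G) :
    Continuous fun q : ℝ × E n => wave G q.1 q.2 := by
  refine continuous_of_dominated (bound := fun ξ => ‖G ξ‖) (fun q => ?_) (fun q => ?_) hG.norm ?_
  · exact (by fun_prop : Continuous fun ξ : E n => Complex.exp
      (((2 * π * (⟪q.2, ξ⟫ + q.1 * ‖ξ‖) : ℝ) : ℂ) * Complex.I)).aestronglyMeasurable.mul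
      hG.aestronglyMeasurable
  · refine .of_forall fun ξ => ?_
    rw [norm_mul, Complex.norm_exp_ofReal_mul_I, one_mul]
  · exact .of_forall fun ξ => by fun_prop

theorem continuous_wave_right {n : ℕ} {G : E n → ℂ} (hG : Integrable G) (t : ℝ) :
    Continuous fun x => wave G t x := by
  have h := continuous_wave hG
  fun_prop

theorem continuous_wave_left {n : ℕ} {G : E n → ℂ} (hG : Integrable G) (x : E n) :
    Continuous fun t => wave G t x := by
  have h := continuous_wave hG
  fun_prop

theorem hasDerivAt_wave {n : ℕ} {G : E n → ℂ} (hG : Integrable G)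
    (hG' : Integrable fun ξ : E n => (2 * π * ‖ξ‖ * Complex.I : ℂ) * G ξ) (x : E n) (t : ℝ) :
    HasDerivAt (fun τ => wave G τ x)
      (wave (fun ξ => (2 * π * ‖ξ‖ * Complex.I : ℂ) * G ξ) t x) t := by
  have hm : ∀ (K : E n → ℂ), Integrable K → ∀ τ : ℝ, AEStronglyMeasurable (fun ξ : E n =>
      Complex.exp (((2 * π * (⟪x, ξ⟫ + τ * ‖ξ‖) : ℝ) : ℂ) * Complex.I) * K ξ) := fun K hK τ =>
    (by fun_prop : Continuous fun ξ : E n => Complex.exp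
      (((2 * π * (⟪x, ξ⟫ + τ * ‖ξ‖) : ℝ) : ℂ) * Complex.I)).aestronglyMeasurable.mul
      hK.aestronglyMeasurable
  refine (hasDerivAt_integral_of_dominated_loc_of_deriv_le (s := Set.univ)
    (F' := fun τ ξ => Complex.exp (((2 * π * (⟪x, ξ⟫ + τ * ‖ξ‖) : ℝ) : ℂ) * Complex.I) *
      ((2 * π * ‖ξ‖ * Complex.I : ℂ) * G ξ))
    (bound := fun ξ => ‖(2 * π * ‖ξ‖ * Complex.I : ℂ) * G ξ‖) Filter.univ_mem
    (.of_forall fun τ => hm G hG τ) ?_ (hm _ hG' t) ?_ hG'.norm ?_).2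
  · refine hG.mono (hm G hG t) (.of_forall fun ξ => ?_)
    rw [norm_mul, Complex.norm_exp_ofReal_mul_I, one_mul]
  · refine .of_forall fun ξ τ _ => ?_
    rw [norm_mul, Complex.norm_exp_ofReal_mul_I, one_mul]
  · refine .of_forall fun ξ τ _ => ?_
    have h1 : HasDerivAt (fun τ : ℝ => 2 * π * (⟪x, ξ⟫ + τ * ‖ξ‖)) (2 * π * ‖ξ‖) τ := by
      simpa using (((hasDerivAt_id τ).mul_const ‖ξ‖).const_add ⟪x, ξ⟫).const_mul (2 * π)
    refine ((h1.ofReal_comp.mul_const Complex.I).cexp.mul_const (G ξ)).congr_deriv ?_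
    push_cast
    ring

theorem measurable_waveSup {n : ℕ} {G : E n → ℂ} (hG : Integrable G) :
    Measurable (waveSup G) := by
  refine LowerSemicontinuous.measurable (lowerSemicontinuous_iSup fun t => ?_)
  exact (continuous_wave_right hG t).enorm.lowerSemicontinuous

/-- A scale-`h` Sobolev inequality on the unit interval. -/
theorem ofReal_mul_enorm_rpow_le {g g' : ℝ → ℂ} (hg : ∀ t, HasDerivAt g (g' t) t)
    (hg' : Continuous g') {p h t : ℝ} (hp : 1 ≤ p) (h0 : 0 < h) (h1 : h ≤ 1)
    (ht : t ∈ Set.Icc (0:ℝ) 1) :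
    ENNReal.ofReal h * ‖g t‖ₑ ^ p ≤ 2 ^ (p - 1) * ((∫⁻ τ in Set.Ioc (0:ℝ) 1, ‖g τ‖ₑ ^ p) +
      ENNReal.ofReal h ^ p * ∫⁻ τ in Set.Ioc (0:ℝ) 1, ‖g' τ‖ₑ ^ p) := by
  have hp0 : 0 < p := one_pos.trans_le hp
  set a := min t (1 - h) with ha
  have ha0 : 0 ≤ a := le_min ht.1 (by linarith)
  have ha1 : a + h ≤ 1 := by linarith [min_le_right t (1 - h)]
  have hat : a ≤ t := min_le_left _ _
  have hta : t ≤ a + h := by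
    rcases min_choice t (1 - h) with hc | hc <;> rw [ha, hc] <;> linarith [ht.2]
  set J := Set.Ioc a (a + h) with hJ
  have hJsub : J ⊆ Set.Ioc 0 1 := Set.Ioc_subset_Ioc ha0 ha1
  have hJvol : volume J = ENNReal.ofReal h := by simp [hJ]
  have hgc : Continuous g := continuous_iff_continuousAt.2 fun t => (hg t).continuousAt
  set I := ∫⁻ τ in J, ‖g' τ‖ₑ with hI
  have hpt : ∀ τ ∈ J, ‖g t‖ₑ ^ p ≤ 2 ^ (p - 1) * (‖g τ‖ₑ ^ p + I ^ p) := by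
    intro τ hτ
    have hd : ‖g t - g τ‖ₑ ≤ I := by
      rw [← intervalIntegral.integral_eq_sub_of_hasDerivAt (fun y _ => hg y)
        (hg'.intervalIntegrable τ t), ← ofReal_norm, intervalIntegral.norm_intervalIntegral_eq,
        ofReal_norm]
      refine (enorm_integral_le_lintegral_enorm _).trans (lintegral_mono_set ?_)
      intro y hy
      rw [Set.mem_uIoc] at hy
      rcases hy with hy | hy
      · exact ⟨hτ.1.trans hy.1, hy.2.trans hta⟩
      · exact ⟨hat.trans_lt hy.1, hy.2.trans hτ.2⟩
    calc ‖g t‖ₑ ^ p ≤ (‖g τ‖ₑ + I) ^ p := by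
          gcongr
          calc ‖g t‖ₑ = ‖g τ + (g t - g τ)‖ₑ := by congr 1; ring
            _ ≤ ‖g τ‖ₑ + ‖g t - g τ‖ₑ := enorm_add_le _ _
            _ ≤ _ := by gcongr
      _ ≤ _ := ENNReal.rpow_add_le_mul_rpow_add_rpow _ _ hp
  have hIp : ENNReal.ofReal h * I ^ p ≤ ENNReal.ofReal h ^ p * ∫⁻ τ in J, ‖g' τ‖ₑ ^ p := by
    have := eLpNorm'_le_eLpNorm'_mul_rpow_measure_univ (μ := volume.restrict J) one_pos hp
      hg'.aestronglyMeasurable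
    simp only [eLpNorm', ENNReal.rpow_one, one_div, inv_one, Measure.restrict_apply_univ,
      hJvol] at this
    have h2 := ENNReal.rpow_le_rpow this hp0.le
    rw [ENNReal.mul_rpow_of_nonneg _ _ hp0.le, ← ENNReal.rpow_mul, ← ENNReal.rpow_mul,
      inv_mul_cancel₀ hp0.ne', ENNReal.rpow_one, sub_mul, inv_mul_cancel₀ hp0.ne', one_mul] at h2
    calc ENNReal.ofReal h * I ^ p
        ≤ ENNReal.ofReal h * ((∫⁻ τ in J, ‖g' τ‖ₑ ^ p) * ENNReal.ofReal h ^ (p - 1)) := by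
          gcongr
      _ = (ENNReal.ofReal h ^ (1:ℝ) * ENNReal.ofReal h ^ (p - 1)) *
            ∫⁻ τ in J, ‖g' τ‖ₑ ^ p := by rw [ENNReal.rpow_one]; ring
      _ = _ := by
        rw [← ENNReal.rpow_add _ _ (by simpa using h0) ENNReal.ofReal_ne_top]
        congr 2; ring
  calc ENNReal.ofReal h * ‖g t‖ₑ ^ p = ∫⁻ _ in J, ‖g t‖ₑ ^ p := by
        rw [setLIntegral_const, hJvol, mul_comm]
    _ ≤ ∫⁻ τ in J, 2 ^ (p - 1) * (‖g τ‖ₑ ^ p + I ^ p) :=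
        setLIntegral_mono' measurableSet_Ioc hpt
    _ = 2 ^ (p - 1) * ((∫⁻ τ in J, ‖g τ‖ₑ ^ p) + ENNReal.ofReal h * I ^ p) := by
        rw [lintegral_const_mul _ (by fun_prop), lintegral_add_right _ measurable_const,
          setLIntegral_const, hJvol, mul_comm (I ^ p)]
    _ ≤ 2 ^ (p - 1) * ((∫⁻ τ in J, ‖g τ‖ₑ ^ p) +
          ENNReal.ofReal h ^ p * ∫⁻ τ in J, ‖g' τ‖ₑ ^ p) := by gcongr
    _ ≤ _ := by gcongr

theorem integrable_weight_mul_sq {n : ℕ} (s : ℝ) (G : SchwartzMap (E n) ℂ) :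
    Integrable fun ξ : E n => (1 + ‖ξ‖ ^ 2) ^ s * ‖G ξ‖ ^ 2 := by
  have ht : (fun ξ : E n => (1 + ‖ξ‖ ^ 2) ^ (s / 2)).HasTemperateGrowth := by fun_prop
  have h := (memLp_two_iff_integrable_sq_norm (μ := (volume : Measure (E n)))
    (SchwartzMap.continuous _).aestronglyMeasurable).1
    ((SchwartzMap.smulLeftCLM ℂ (fun ξ : E n => (1 + ‖ξ‖ ^ 2) ^ (s / 2)) G).memLp 2)
  refine h.congr (.of_forall fun ξ => ?_)
  have h0 : 0 < 1 + ‖ξ‖ ^ 2 := by positivity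
  simp only [SchwartzMap.smulLeftCLM_apply_apply ht, norm_smul, mul_pow]
  rw [Real.norm_of_nonneg (by positivity), ← Real.rpow_natCast, ← Real.rpow_mul h0.le]
  congr 2
  push_cast
  ring

theorem lintegral_weight_mul_sq_eq_ofReal {n : ℕ} (s : ℝ) (G : SchwartzMap (E n) ℂ) :
    ∫⁻ ξ : E n, ENNReal.ofReal ((1 + ‖ξ‖ ^ 2) ^ s) * ‖G ξ‖ₑ ^ 2 =
      ENNReal.ofReal (∫ ξ : E n, (1 + ‖ξ‖ ^ 2) ^ s * ‖G ξ‖ ^ 2) := by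
  rw [ofReal_integral_eq_lintegral_ofReal (integrable_weight_mul_sq s G)
    (.of_forall fun ξ => by positivity)]
  refine lintegral_congr fun ξ => ?_
  rw [ENNReal.ofReal_mul (by positivity), ENNReal.ofReal_pow (norm_nonneg _), ofReal_norm]

theorem FT_eq_fourier {n : ℕ} (f : SchwartzMap (E n) ℂ) :
    FT (⇑f) = ⇑(FourierTransform.fourier f) := by
  ext ξ
  rw [SchwartzMap.fourier_coe, Real.fourier_eq']
  rfl

theorem ofReal_sobolevNorm {n : ℕ} (s : ℝ) (f : SchwartzMap (E n) ℂ) :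
    ENNReal.ofReal (sobolevNorm (⇑f) s) = weightedNorm s (FT (⇑f)) := by
  rw [FT_eq_fourier, weightedNorm, lintegral_weight_mul_sq_eq_ofReal, sobolevNorm,
    FT_eq_fourier, ENNReal.ofReal_rpow_of_nonneg (integral_nonneg fun ξ => by positivity)
      (by norm_num)]

theorem measurable_enorm_wave_rpow {n : ℕ} {G : E n → ℂ} (hG : Integrable G) (p : ℝ) :
    Measurable fun q : ℝ × E n => ‖wave G q.1 q.2‖ₑ ^ p :=
  (continuous_wave hG).enorm.measurable.pow_const p

theorem lintegral_enorm_wave_rpow_lt_top {n : ℕ} {G : E n → ℂ} (hG : Integrable G) {p : ℝ}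
    (hp : 0 ≤ p) (μ : Measure (E n)) [IsFiniteMeasure μ] (t : ℝ) :
    ∫⁻ x, ‖wave G t x‖ₑ ^ p ∂μ < ⊤ := by
  calc ∫⁻ x, ‖wave G t x‖ₑ ^ p ∂μ ≤ ∫⁻ _, (∫⁻ ξ, ‖G ξ‖ₑ) ^ p ∂μ := by
        gcongr with x
        exact enorm_wave_le G t x
    _ < ⊤ := by
        rw [lintegral_const]
        exact ENNReal.mul_lt_top (ENNReal.rpow_lt_top_of_nonneg hp hG.2.ne) (measure_lt_top _ _)

theorem ofReal_integral_norm_wave_rpow {n : ℕ} {G : E n → ℂ} (hG : Integrable G) {p : ℝ}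
    (hp : 0 ≤ p) (μ : Measure (E n)) [IsFiniteMeasure μ] :
    ENNReal.ofReal (∫ t in (0:ℝ)..1, ∫ x, ‖wave G t x‖ ^ p ∂μ) =
      ∫⁻ t in Set.Ioc (0:ℝ) 1, ∫⁻ x, ‖wave G t x‖ₑ ^ p ∂μ := by
  have hm := measurable_enorm_wave_rpow hG p
  have hin : ∀ t : ℝ, ∫ x, ‖wave G t x‖ ^ p ∂μ = (∫⁻ x, ‖wave G t x‖ₑ ^ p ∂μ).toReal := by
    intro t
    have hmt : Measurable fun x => ‖wave G t x‖ₑ ^ p :=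
      (continuous_wave_right hG t).enorm.measurable.pow_const p
    have hlt : ∀ x, ‖wave G t x‖ₑ ^ p < ⊤ := fun x =>
      ENNReal.rpow_lt_top_of_nonneg hp enorm_ne_top
    rw [← integral_toReal hmt.aemeasurable (.of_forall hlt)]
    simp [← ENNReal.toReal_rpow]
  have hmI : Measurable fun t : ℝ => ∫⁻ x, ‖wave G t x‖ₑ ^ p ∂μ :=
    hm.lintegral_prod_right' (ν := μ)
  have hlt : ∀ t : ℝ, ∫⁻ x, ‖wave G t x‖ₑ ^ p ∂μ < ⊤ := fun t =>
    lintegral_enorm_wave_rpow_lt_top hG hp μ t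
  simp_rw [hin]
  rw [intervalIntegral.integral_of_le zero_le_one,
    integral_toReal hmI.aemeasurable (.of_forall hlt), ENNReal.ofReal_toReal]
  refine ne_top_of_le_ne_top (b := ∫⁻ t in Set.Ioc (0:ℝ) 1, ∫⁻ x, (∫⁻ ξ, ‖G ξ‖ₑ) ^ p ∂μ) ?_ ?_
  · simp only [lintegral_const]
    finiteness [hG.2.ne]
  · gcongr with t x
    exact enorm_wave_le G t x

/-- The Strichartz hypothesis in terms of a smooth compactly supported frequency profile. -/
theorem lintegral_enorm_wave_rpow_le {n : ℕ} {p s α C : ℝ} (hp : 1 ≤ p) (hC : 0 < C)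
    (H : ∀ (f : SchwartzMap (E n) ℂ) (μ : Measure (E n)), IsFiniteMeasure μ →
      μ (Metric.ball (0 : E n) 1)ᶜ = 0 → frostman μ α < ⊤ →
      (∫ t in (0:ℝ)..1, ∫ x, ‖halfWave (⇑f) t x‖ ^ p ∂μ) ^ (1/p) ≤
        C * (frostman μ α).toReal ^ (1/p) * sobolevNorm (⇑f) s)
    {G : E n → ℂ} (hG : HasCompactSupport G) (hG' : ContDiff ℝ (⊤ : ℕ∞) G) (μ : Measure (E n))
    [IsFiniteMeasure μ] (hμ : μ (Metric.ball (0 : E n) 1)ᶜ = 0) (hα : frostman μ α < ⊤) :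
    ∫⁻ t in Set.Ioc (0:ℝ) 1, ∫⁻ x, ‖wave G t x‖ₑ ^ p ∂μ ≤
      ENNReal.ofReal C ^ p * frostman μ α * weightedNorm s G ^ p := by
  have hp0 : 0 < p := one_pos.trans_le hp
  set f : SchwartzMap (E n) ℂ := FourierTransformInv.fourierInv (hG.toSchwartzMap hG') with hf
  have hFT : FT (⇑f) = G := by
    rw [FT_eq_fourier, hf, FourierInvPair.fourier_fourierInv_eq]
    rfl
  have hw : halfWave (⇑f) = wave G := by rw [← hFT]; rfl
  have hint : Integrable G := hG'.continuous.integrable_of_hasCompactSupport hG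
  have h := ENNReal.ofReal_le_ofReal (H f μ inferInstance hμ hα)
  have hnn : 0 ≤ ∫ t in (0:ℝ)..1, ∫ x, ‖wave G t x‖ ^ p ∂μ :=
    intervalIntegral.integral_nonneg zero_le_one fun t _ => integral_nonneg fun x => by positivity
  rw [hw, ← ENNReal.ofReal_rpow_of_nonneg hnn (by positivity),
    ofReal_integral_norm_wave_rpow hint hp0.le, ENNReal.ofReal_mul (by positivity),
    ENNReal.ofReal_mul hC.le, ← ENNReal.ofReal_rpow_of_nonneg ENNReal.toReal_nonneg (by positivity),
    ENNReal.ofReal_toReal hα.ne, ofReal_sobolevNorm, hFT] at h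
  have h2 := ENNReal.rpow_le_rpow h hp0.le
  rwa [ENNReal.mul_rpow_of_nonneg _ _ hp0.le, ENNReal.mul_rpow_of_nonneg _ _ hp0.le,
    ← ENNReal.rpow_mul, ← ENNReal.rpow_mul, one_div_mul_cancel hp0.ne', ENNReal.rpow_one,
    ENNReal.rpow_one] at h2

theorem ENNReal.iSup_rpow_eq {ι : Sort*} (f : ι → ℝ≥0∞) {p : ℝ} (hp : 0 < p) :
    (⨆ i, f i) ^ p = ⨆ i, f i ^ p :=
  (ENNReal.orderIsoRpow p hp).map_iSup f

/-- Minkowski's inequality for countable sums. -/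
theorem ENNReal.lintegral_Lp_tsum_le {β : Type*} [MeasurableSpace β] {μ : Measure β} {p : ℝ}
    (hp : 1 ≤ p) {f : ℕ → β → ℝ≥0∞} (hf : ∀ k, Measurable (f k)) :
    (∫⁻ x, (∑' k, f k x) ^ p ∂μ) ^ (1 / p) ≤ ∑' k, (∫⁻ x, f k x ^ p ∂μ) ^ (1 / p) := by
  have hp0 : 0 < p := one_pos.trans_le hp
  have hfin : ∀ N : ℕ, (∫⁻ x, (∑ k ∈ Finset.range N, f k x) ^ p ∂μ) ^ (1 / p) ≤
      ∑ k ∈ Finset.range N, (∫⁻ x, f k x ^ p ∂μ) ^ (1 / p) := by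
    intro N
    induction N with
    | zero => simp [hp0]
    | succ N ih =>
      simp only [Finset.sum_range_succ]
      refine (ENNReal.lintegral_Lp_add_le (f := fun x => ∑ k ∈ Finset.range N, f k x)
        (Finset.measurable_fun_sum _ fun k _ => hf k).aemeasurable (hf N).aemeasurable hp).trans ?_
      gcongr
  simp_rw [ENNReal.tsum_eq_iSup_nat (f := fun k => f k _), ENNReal.iSup_rpow_eq _ hp0]
  rw [lintegral_iSup (fun N => (Finset.measurable_fun_sum _ fun k _ => hf k).pow_const p),
    ENNReal.iSup_rpow_eq _ (by positivity)]
  · exact iSup_le fun N => (hfin N).trans (ENNReal.sum_le_tsum _)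
  · intro M N hMN x
    dsimp only
    gcongr

theorem weightedNorm_le_of_support {n : ℕ} {s s' c r : ℝ} (hs : s ≤ s') (hc : 0 ≤ c) (hr : 0 < r)
    {G K : E n → ℂ} (hG : Measurable G) (hK : ∀ ξ, K ξ ≠ 0 → r ≤ ‖ξ‖ ∧ ‖K ξ‖ ≤ c * ‖G ξ‖) :
    weightedNorm s K ≤ ENNReal.ofReal (c * r ^ (s - s')) * weightedNorm s' G := by
  have hpt : ∀ ξ : E n, ENNReal.ofReal ((1 + ‖ξ‖ ^ 2) ^ s) * ‖K ξ‖ₑ ^ 2 ≤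
      ENNReal.ofReal (c * r ^ (s - s')) ^ 2 *
        (ENNReal.ofReal ((1 + ‖ξ‖ ^ 2) ^ s') * ‖G ξ‖ₑ ^ 2) := by
    intro ξ
    by_cases h0 : K ξ = 0
    · simp [h0]
    obtain ⟨h1, h2⟩ := hK ξ h0
    have hpos : 0 < 1 + ‖ξ‖ ^ 2 := by positivity
    simp only [← ofReal_norm]
    rw [← ENNReal.ofReal_pow (by positivity), ← ENNReal.ofReal_pow (by positivity),
      ← ENNReal.ofReal_pow (by positivity), ← ENNReal.ofReal_mul (by positivity),
      ← ENNReal.ofReal_mul (by positivity), ← ENNReal.ofReal_mul (by positivity)]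
    refine ENNReal.ofReal_le_ofReal ?_
    have h3 : (1 + ‖ξ‖ ^ 2) ^ (s - s') ≤ (r ^ (s - s')) ^ 2 := by
      calc (1 + ‖ξ‖ ^ 2) ^ (s - s') ≤ (r ^ 2) ^ (s - s') :=
            Real.rpow_le_rpow_of_nonpos (by positivity) (by nlinarith) (by linarith)
        _ = _ := by rw [← Real.rpow_natCast, ← Real.rpow_natCast, ← Real.rpow_mul hr.le,
            ← Real.rpow_mul hr.le, mul_comm]
    calc (1 + ‖ξ‖ ^ 2) ^ s * ‖K ξ‖ ^ 2
        = (1 + ‖ξ‖ ^ 2) ^ (s - s') * (1 + ‖ξ‖ ^ 2) ^ s' * ‖K ξ‖ ^ 2 := by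
          rw [← Real.rpow_add hpos, sub_add_cancel]
      _ ≤ (r ^ (s - s')) ^ 2 * (1 + ‖ξ‖ ^ 2) ^ s' * (c * ‖G ξ‖) ^ 2 := by gcongr
      _ = _ := by ring
  calc weightedNorm s K ≤ (∫⁻ ξ : E n, ENNReal.ofReal (c * r ^ (s - s')) ^ 2 *
        (ENNReal.ofReal ((1 + ‖ξ‖ ^ 2) ^ s') * ‖G ξ‖ₑ ^ 2)) ^ (1 / 2 : ℝ) := by
        exact ENNReal.rpow_le_rpow (lintegral_mono hpt) (by norm_num)
    _ = _ := by
        rw [lintegral_const_mul _ (by fun_prop), ENNReal.mul_rpow_of_nonneg _ _ (by norm_num),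
          ← ENNReal.rpow_natCast, ← ENNReal.rpow_mul, weightedNorm]
        norm_num

theorem lintegral_enorm_le_of_support {n : ℕ} {s r : ℝ} (hs : 0 ≤ s) {G K : E n → ℂ}
    (hG : Measurable G) (hle : ∀ ξ, ‖K ξ‖ ≤ ‖G ξ‖) (hK : ∀ ξ, r ≤ ‖ξ‖ → K ξ = 0) :
    ∫⁻ ξ, ‖K ξ‖ₑ ≤ volume (Metric.ball (0 : E n) r) ^ (1/2 : ℝ) * weightedNorm s G := by
  have h1 : ∫⁻ ξ, ‖K ξ‖ₑ ≤ ∫⁻ ξ in Metric.ball (0 : E n) r, ‖G ξ‖ₑ := by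
    rw [← lintegral_indicator measurableSet_ball]
    refine lintegral_mono fun ξ => ?_
    by_cases hξ : ξ ∈ Metric.ball (0 : E n) r
    · rw [Set.indicator_of_mem hξ]
      exact enorm_le_iff_norm_le.2 (hle ξ)
    · rw [hK ξ (by simpa using hξ)]
      simp
  have h2 := ENNReal.lintegral_mul_le_Lp_mul_Lq (volume.restrict (Metric.ball (0 : E n) r))
    Real.HolderConjugate.two_two (f := fun _ => 1) (g := fun ξ => ‖G ξ‖ₑ) measurable_const.aemeasurable
    hG.enorm.aemeasurable
  simp only [Pi.mul_apply, one_mul, ENNReal.one_rpow, lintegral_const,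
    Measure.restrict_apply_univ] at h2
  refine h1.trans (h2.trans (mul_le_mul' le_rfl (ENNReal.rpow_le_rpow ?_ (by positivity))))
  refine (setLIntegral_le_lintegral _ _).trans (lintegral_mono fun ξ => ?_)
  have h3 : 1 ≤ ENNReal.ofReal ((1 + ‖ξ‖ ^ 2) ^ s) := by
    rw [ENNReal.one_le_ofReal]
    exact Real.one_le_rpow (by nlinarith [norm_nonneg ξ]) hs
  calc ‖G ξ‖ₑ ^ (2:ℝ) = 1 * ‖G ξ‖ₑ ^ 2 := by rw [one_mul]; norm_cast
    _ ≤ _ := by gcongr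

theorem waveSup_le_lintegral {n : ℕ} (G : E n → ℂ) (x : E n) :
    waveSup G x ≤ ∫⁻ ξ, ‖G ξ‖ₑ :=
  iSup_le fun t => enorm_wave_le G t x

/-- The maximal function of a profile supported in `{r ≤ |ξ| ≤ 4r}` that is dominated by `G`. -/
theorem lintegral_waveSup_rpow_le {n : ℕ} {p s s' α C : ℝ} (hp : 1 ≤ p) (hC : 0 < C)
    (H : ∀ (f : SchwartzMap (E n) ℂ) (μ : Measure (E n)), IsFiniteMeasure μ →
      μ (Metric.ball (0 : E n) 1)ᶜ = 0 → frostman μ α < ⊤ →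
      (∫ t in (0:ℝ)..1, ∫ x, ‖halfWave (⇑f) t x‖ ^ p ∂μ) ^ (1/p) ≤
        C * (frostman μ α).toReal ^ (1/p) * sobolevNorm (⇑f) s)
    (hs : s ≤ s') {r : ℝ} (hr : 1 ≤ r) {G K : E n → ℂ} (hG : Measurable G)
    (hKc : HasCompactSupport K) (hKd : ContDiff ℝ (⊤ : ℕ∞) K) (hle : ∀ ξ, ‖K ξ‖ ≤ ‖G ξ‖)
    (hlow : ∀ ξ, ‖ξ‖ < r → K ξ = 0) (hhigh : ∀ ξ, 4 * r ≤ ‖ξ‖ → K ξ = 0) (μ : Measure (E n))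
    [IsFiniteMeasure μ] (hμ : μ (Metric.ball (0 : E n) 1)ᶜ = 0) (hα : frostman μ α < ⊤) :
    (∫⁻ x, waveSup K x ^ p ∂μ) ^ (1/p) ≤
      (2 ^ (p - 1) * (1 + ENNReal.ofReal (8 * π) ^ p)) ^ (1/p) * ENNReal.ofReal C *
        frostman μ α ^ (1/p) * weightedNorm s' G * ENNReal.ofReal (r ^ (1/p + s - s')) := by
  have hp0 : 0 < p := one_pos.trans_le hp
  have hr0 : 0 < r := one_pos.trans_le hr
  set K' : E n → ℂ := fun ξ => (2 * π * ‖ξ‖ * Complex.I : ℂ) * K ξ with hK'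
  have hKc' : HasCompactSupport K' := hKc.mul_left
  have hKd' : ContDiff ℝ (⊤ : ℕ∞) K' := by
    rw [contDiff_iff_contDiffAt]
    intro ξ
    rcases eq_or_ne ξ 0 with rfl | hξ
    · refine (contDiffAt_const (c := (0:ℂ))).congr_of_eventuallyEq ?_
      filter_upwards [Metric.ball_mem_nhds (0 : E n) hr0] with η hη
      simp [hK', hlow η (by simpa using hη)]
    · have h1 : ContDiffAt ℝ (⊤ : ℕ∞) (fun ξ : E n => ((‖ξ‖ : ℝ) : ℂ)) ξ :=
        Complex.ofRealCLM.contDiff.contDiffAt.comp ξ (contDiffAt_norm ℝ hξ)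
      exact ((contDiffAt_const.mul h1).mul contDiffAt_const).mul hKd.contDiffAt
  have hKi : Integrable K := hKd.continuous.integrable_of_hasCompactSupport hKc
  have hKi' : Integrable K' := hKd'.continuous.integrable_of_hasCompactSupport hKc'
  have hsupp : ∀ ξ, K ξ ≠ 0 → r ≤ ‖ξ‖ ∧ ‖ξ‖ ≤ 4 * r := fun ξ h =>
    ⟨not_lt.1 fun h' => h (hlow ξ h'), (not_le.1 fun h' => h (hhigh ξ h')).le⟩
  have hN : weightedNorm s K ≤ ENNReal.ofReal (r ^ (s - s')) * weightedNorm s' G := by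
    have := weightedNorm_le_of_support (K := K) hs zero_le_one hr0 hG
      fun ξ h => ⟨(hsupp ξ h).1, by simpa using hle ξ⟩
    rwa [one_mul] at this
  have hN' : weightedNorm s K' ≤
      ENNReal.ofReal (8 * π * r * r ^ (s - s')) * weightedNorm s' G := by
    refine weightedNorm_le_of_support hs (by positivity) hr0 hG fun ξ h => ?_
    have hKξ : K ξ ≠ 0 := fun h0 => h (by simp [hK', h0])
    refine ⟨(hsupp ξ hKξ).1, ?_⟩
    have h1 : ‖K' ξ‖ = 2 * π * ‖ξ‖ * ‖K ξ‖ := by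
      simp [hK', abs_of_pos Real.pi_pos]
    rw [h1]
    calc 2 * π * ‖ξ‖ * ‖K ξ‖ ≤ 2 * π * (4 * r) * ‖G ξ‖ := by
          gcongr
          · exact (hsupp ξ hKξ).2
          · exact hle ξ
      _ = _ := by ring
  have hS := lintegral_enorm_wave_rpow_le hp hC H hKc hKd μ hμ hα
  have hS' := lintegral_enorm_wave_rpow_le hp hC H hKc' hKd' μ hμ hα
  have hm := measurable_enorm_wave_rpow hKi p
  have hm' := measurable_enorm_wave_rpow hKi' p
  have hmx : Measurable fun x => ∫⁻ τ in Set.Ioc (0:ℝ) 1, ‖wave K τ x‖ₑ ^ p :=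
    hm.lintegral_prod_left' (μ := volume.restrict (Set.Ioc (0:ℝ) 1))
  have hmx' : Measurable fun x => ∫⁻ τ in Set.Ioc (0:ℝ) 1, ‖wave K' τ x‖ₑ ^ p :=
    hm'.lintegral_prod_left' (μ := volume.restrict (Set.Ioc (0:ℝ) 1))
  have hswap : ∫⁻ x, (∫⁻ τ in Set.Ioc (0:ℝ) 1, ‖wave K τ x‖ₑ ^ p) ∂μ =
      ∫⁻ τ in Set.Ioc (0:ℝ) 1, ∫⁻ x, ‖wave K τ x‖ₑ ^ p ∂μ :=
    (lintegral_lintegral_swap hm.aemeasurable).symm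
  have hswap' : ∫⁻ x, (∫⁻ τ in Set.Ioc (0:ℝ) 1, ‖wave K' τ x‖ₑ ^ p) ∂μ =
      ∫⁻ τ in Set.Ioc (0:ℝ) 1, ∫⁻ x, ‖wave K' τ x‖ₑ ^ p ∂μ :=
    (lintegral_lintegral_swap hm'.aemeasurable).symm
  have hpt : ∀ x, ENNReal.ofReal r⁻¹ * waveSup K x ^ p ≤
      2 ^ (p - 1) * ((∫⁻ τ in Set.Ioc (0:ℝ) 1, ‖wave K τ x‖ₑ ^ p) +
        ENNReal.ofReal r⁻¹ ^ p * ∫⁻ τ in Set.Ioc (0:ℝ) 1, ‖wave K' τ x‖ₑ ^ p) := by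
    intro x
    rw [waveSup, ENNReal.iSup_rpow_eq _ hp0, ENNReal.mul_iSup]
    exact iSup_le fun t => ofReal_mul_enorm_rpow_le (fun τ => hasDerivAt_wave hKi hKi' x τ)
      (continuous_wave_left hKi' x) hp (by positivity) (inv_le_one_of_one_le₀ hr) t.2
  set F := frostman μ α with hF
  set N := weightedNorm s' G with hNdef
  have key : ENNReal.ofReal r⁻¹ * ∫⁻ x, waveSup K x ^ p ∂μ ≤
      2 ^ (p - 1) * (1 + ENNReal.ofReal (8 * π) ^ p) * (ENNReal.ofReal C ^ p * F) *
        (ENNReal.ofReal (r ^ (s - s')) * N) ^ p := by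
    calc ENNReal.ofReal r⁻¹ * ∫⁻ x, waveSup K x ^ p ∂μ
        = ∫⁻ x, ENNReal.ofReal r⁻¹ * waveSup K x ^ p ∂μ :=
          (lintegral_const_mul _ ((measurable_waveSup hKi).pow_const p)).symm
      _ ≤ ∫⁻ x, 2 ^ (p - 1) * ((∫⁻ τ in Set.Ioc (0:ℝ) 1, ‖wave K τ x‖ₑ ^ p) +
          ENNReal.ofReal r⁻¹ ^ p * ∫⁻ τ in Set.Ioc (0:ℝ) 1, ‖wave K' τ x‖ₑ ^ p) ∂μ :=
          lintegral_mono hpt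
      _ = 2 ^ (p - 1) * ((∫⁻ τ in Set.Ioc (0:ℝ) 1, ∫⁻ x, ‖wave K τ x‖ₑ ^ p ∂μ) +
          ENNReal.ofReal r⁻¹ ^ p * ∫⁻ τ in Set.Ioc (0:ℝ) 1, ∫⁻ x, ‖wave K' τ x‖ₑ ^ p ∂μ) := by
          rw [lintegral_const_mul _ (by fun_prop), lintegral_add_left hmx,
            lintegral_const_mul _ hmx', hswap, hswap']
      _ ≤ 2 ^ (p - 1) * (ENNReal.ofReal C ^ p * F * (ENNReal.ofReal (r ^ (s - s')) * N) ^ p +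
          ENNReal.ofReal r⁻¹ ^ p * (ENNReal.ofReal C ^ p * F *
            (ENNReal.ofReal (8 * π * r * r ^ (s - s')) * N) ^ p)) := by
          gcongr
          · exact hS.trans (by gcongr)
          · exact hS'.trans (by gcongr)
      _ = 2 ^ (p - 1) * (ENNReal.ofReal C ^ p * F * (ENNReal.ofReal (r ^ (s - s')) * N) ^ p +
          ENNReal.ofReal C ^ p * F * (ENNReal.ofReal r⁻¹ *
            (ENNReal.ofReal (8 * π * r * r ^ (s - s')) * N)) ^ p) := by
          rw [ENNReal.mul_rpow_of_nonneg (ENNReal.ofReal r⁻¹) _ hp0.le]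
          ring
      _ = 2 ^ (p - 1) * (ENNReal.ofReal C ^ p * F * (ENNReal.ofReal (r ^ (s - s')) * N) ^ p +
          ENNReal.ofReal C ^ p * F * (ENNReal.ofReal (8 * π) *
            (ENNReal.ofReal (r ^ (s - s')) * N)) ^ p) := by
          rw [← mul_assoc (ENNReal.ofReal r⁻¹), ← mul_assoc (ENNReal.ofReal (8 * π)),
            ← ENNReal.ofReal_mul (by positivity), ← ENNReal.ofReal_mul (by positivity)]
          congr 6
          field_simp
      _ = _ := by
          rw [ENNReal.mul_rpow_of_nonneg (ENNReal.ofReal (8 * π)) _ hp0.le]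
          ring
  have key2 : ∫⁻ x, waveSup K x ^ p ∂μ ≤ ENNReal.ofReal r *
      (2 ^ (p - 1) * (1 + ENNReal.ofReal (8 * π) ^ p) * (ENNReal.ofReal C ^ p * F) *
        (ENNReal.ofReal (r ^ (s - s')) * N) ^ p) := by
    calc ∫⁻ x, waveSup K x ^ p ∂μ
        = ENNReal.ofReal r * (ENNReal.ofReal r⁻¹ * ∫⁻ x, waveSup K x ^ p ∂μ) := by
          rw [← mul_assoc, ← ENNReal.ofReal_mul hr0.le, mul_inv_cancel₀ hr0.ne',
            ENNReal.ofReal_one, one_mul]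
      _ ≤ _ := by gcongr
  have hpinv : 0 ≤ 1 / p := by positivity
  refine (ENNReal.rpow_le_rpow key2 hpinv).trans_eq ?_
  have hroot : ∀ a : ℝ≥0∞, (a ^ p) ^ (1 / p) = a := fun a => by
    rw [← ENNReal.rpow_mul, mul_one_div_cancel hp0.ne', ENNReal.rpow_one]
  rw [show 1 / p + s - s' = 1 / p + (s - s') by ring, Real.rpow_add hr0,
    ENNReal.ofReal_mul (p := r ^ (1 / p)) (by positivity),
    ← ENNReal.ofReal_rpow_of_nonneg hr0.le hpinv,
    ENNReal.mul_rpow_of_nonneg _ _ hpinv, ENNReal.mul_rpow_of_nonneg _ _ hpinv,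
    ENNReal.mul_rpow_of_nonneg _ _ hpinv, ENNReal.mul_rpow_of_nonneg _ F hpinv, hroot, hroot]
  ring

theorem wave_sub {n : ℕ} {G K : E n → ℂ} (hG : Integrable G) (hK : Integrable K) (t : ℝ)
    (x : E n) : wave (fun ξ => G ξ - K ξ) t x = wave G t x - wave K t x := by
  have hi : ∀ (J : E n → ℂ), Integrable J → Integrable (fun ξ : E n =>
      Complex.exp (((2 * π * (⟪x, ξ⟫ + t * ‖ξ‖) : ℝ) : ℂ) * Complex.I) * J ξ) := by
    intro J hJ
    refine hJ.mono ((by fun_prop : Continuous fun ξ : E n => Complex.exp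
      (((2 * π * (⟪x, ξ⟫ + t * ‖ξ‖) : ℝ) : ℂ) * Complex.I)).aestronglyMeasurable.mul
      hJ.aestronglyMeasurable) (.of_forall fun ξ => ?_)
    rw [norm_mul, Complex.norm_exp_ofReal_mul_I, one_mul]
  simp only [wave]
  rw [← integral_sub (hi G hG) (hi K hK)]
  simp only [mul_sub]

theorem tendsto_wave {n : ℕ} {G : E n → ℂ} {L : ℕ → E n → ℂ} (hG : Integrable G)
    (hL : ∀ k, Integrable (L k)) (hle : ∀ k ξ, ‖L k ξ‖ ≤ ‖G ξ‖)
    (hlim : ∀ ξ, Filter.Tendsto (fun k => L k ξ) Filter.atTop (nhds (G ξ))) (t : ℝ) (x : E n) :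
    Filter.Tendsto (fun k => wave (L k) t x) Filter.atTop (nhds (wave G t x)) := by
  refine tendsto_integral_of_dominated_convergence (fun ξ => ‖G ξ‖) (fun k => ?_) hG.norm
    (fun k => .of_forall fun ξ => ?_) (.of_forall fun ξ => (hlim ξ).const_mul _)
  · exact (by fun_prop : Continuous fun ξ : E n => Complex.exp
      (((2 * π * (⟪x, ξ⟫ + t * ‖ξ‖) : ℝ) : ℂ) * Complex.I)).aestronglyMeasurable.mul
      (hL k).aestronglyMeasurable
  · rw [norm_mul, Complex.norm_exp_ofReal_mul_I, one_mul]
    exact hle k ξ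

theorem waveSup_le_add_tsum {n : ℕ} {G : E n → ℂ} {L : ℕ → E n → ℂ} (hG : Integrable G)
    (hL : ∀ k, Integrable (L k)) (hle : ∀ k ξ, ‖L k ξ‖ ≤ ‖G ξ‖)
    (hlim : ∀ ξ, Filter.Tendsto (fun k => L k ξ) Filter.atTop (nhds (G ξ))) (x : E n) :
    waveSup G x ≤ waveSup (L 0) x + ∑' k, waveSup (fun ξ => L (k + 1) ξ - L k ξ) x := by
  refine iSup_le fun t => ?_
  refine le_of_tendsto' (tendsto_wave hG hL hle hlim t x).enorm fun N => ?_
  have hsup : ∀ J : E n → ℂ, ‖wave J t x‖ₑ ≤ waveSup J x := fun J =>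
    le_iSup (fun t : Set.Icc (0:ℝ) 1 => ‖wave J t x‖ₑ) t
  have hN : ‖wave (L N) t x‖ₑ ≤ waveSup (L 0) x +
      ∑ k ∈ Finset.range N, waveSup (fun ξ => L (k + 1) ξ - L k ξ) x := by
    induction N with
    | zero => simpa using hsup (L 0)
    | succ N ih =>
      rw [Finset.sum_range_succ, ← add_assoc]
      calc ‖wave (L (N + 1)) t x‖ₑ
          = ‖wave (L N) t x + wave (fun ξ => L (N + 1) ξ - L N ξ) t x‖ₑ := by
            rw [wave_sub (hL _) (hL _), add_sub_cancel]
        _ ≤ ‖wave (L N) t x‖ₑ + ‖wave (fun ξ => L (N + 1) ξ - L N ξ) t x‖ₑ := enorm_add_le _ _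
        _ ≤ _ := add_le_add ih (hsup _)
  exact hN.trans (by gcongr; exact ENNReal.sum_le_tsum _)

/-- A smooth cutoff equal to `1` on `|ξ| ≤ 2^k` and vanishing for `|ξ| ≥ 2^(k+1)`. -/
def lowPass (n k : ℕ) : ContDiffBump (0 : E n) where
  rIn := 2 ^ k
  rOut := 2 ^ (k + 1)
  rIn_pos := by positivity
  rIn_lt_rOut := pow_lt_pow_right₀ one_lt_two k.lt_succ_self

theorem lowPass_eq_one {n k : ℕ} {ξ : E n} (h : ‖ξ‖ ≤ 2 ^ k) : lowPass n k ξ = 1 :=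
  (lowPass n k).one_of_mem_closedBall (by simpa [lowPass] using h)

theorem lowPass_eq_zero {n k : ℕ} {ξ : E n} (h : 2 ^ (k + 1) ≤ ‖ξ‖) : lowPass n k ξ = 0 :=
  (lowPass n k).zero_of_le_dist (by simpa [lowPass] using h)

theorem measure_univ_le_frostman {n : ℕ} {μ : Measure (E n)}
    (hμ : μ (Metric.ball (0 : E n) 1)ᶜ = 0) (α : ℝ) : μ Set.univ ≤ frostman μ α := by
  have h1 : μ (Metric.ball (0 : E n) 1) / ENNReal.ofReal ((1:ℝ) ^ α) ≤ frostman μ α :=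
    le_iSup_of_le 0 (le_iSup_of_le 1 (le_iSup_of_le one_pos le_rfl))
  rw [Real.one_rpow, ENNReal.ofReal_one, div_one] at h1
  refine le_trans ?_ h1
  rw [← Set.union_compl_self (Metric.ball (0 : E n) 1)]
  exact (measure_union_le _ _).trans (by rw [hμ, add_zero])

theorem lintegral_waveSup_schwartz_rpow_le {n : ℕ} {p s s' α C : ℝ} (hp : 1 ≤ p) (hC : 0 < C)
    (H : ∀ (f : SchwartzMap (E n) ℂ) (μ : Measure (E n)), IsFiniteMeasure μ →
      μ (Metric.ball (0 : E n) 1)ᶜ = 0 → frostman μ α < ⊤ →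
      (∫ t in (0:ℝ)..1, ∫ x, ‖halfWave (⇑f) t x‖ ^ p ∂μ) ^ (1/p) ≤
        C * (frostman μ α).toReal ^ (1/p) * sobolevNorm (⇑f) s)
    (hs : s ≤ s') (hs' : 0 ≤ s') (G : SchwartzMap (E n) ℂ) (μ : Measure (E n))
    [IsFiniteMeasure μ] (hμ : μ (Metric.ball (0 : E n) 1)ᶜ = 0) (hα : frostman μ α < ⊤) :
    (∫⁻ x, waveSup G x ^ p ∂μ) ^ (1/p) ≤
      (volume (Metric.ball (0 : E n) 2) ^ (1/2 : ℝ) +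
        (2 ^ (p - 1) * (1 + ENNReal.ofReal (8 * π) ^ p)) ^ (1/p) * ENNReal.ofReal C *
          (1 - ENNReal.ofReal (2 ^ (1/p + s - s')))⁻¹) *
        frostman μ α ^ (1/p) * weightedNorm s' G := by
  have hp0 : 0 < p := one_pos.trans_le hp
  set L : ℕ → E n → ℂ := fun k ξ => ((lowPass n k ξ : ℝ) : ℂ) * G ξ with hL
  set K : ℕ → E n → ℂ := fun k ξ => L (k + 1) ξ - L k ξ with hK
  have hLd : ∀ k, ContDiff ℝ (⊤ : ℕ∞) (L k) := fun k =>
    (Complex.ofRealCLM.contDiff.comp (lowPass n k).contDiff).mul (G.smooth _)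
  have hLc : ∀ k, HasCompactSupport (L k) := fun k =>
    ((lowPass n k).hasCompactSupport.comp_left (g := fun y : ℝ => (y : ℂ))
      Complex.ofReal_zero).mul_right
  have hLi : ∀ k, Integrable (L k) := fun k =>
    (hLd k).continuous.integrable_of_hasCompactSupport (hLc k)
  have hKi : ∀ k, Integrable (K k) := fun k => (hLi (k + 1)).sub (hLi k)
  have hb : ∀ (c : ℝ) ξ, |c| ≤ 1 → ‖(c : ℂ) * G ξ‖ ≤ ‖G ξ‖ := fun c ξ hc => by
    rw [norm_mul, Complex.norm_real, Real.norm_eq_abs]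
    exact mul_le_of_le_one_left (norm_nonneg _) hc
  have hLle : ∀ k ξ, ‖L k ξ‖ ≤ ‖G ξ‖ := fun k ξ => hb _ _ (by
    rw [abs_of_nonneg (lowPass n k).nonneg]
    exact (lowPass n k).le_one)
  have hKle : ∀ k ξ, ‖K k ξ‖ ≤ ‖G ξ‖ := by
    intro k ξ
    have h1 : K k ξ = ((lowPass n (k + 1) ξ - lowPass n k ξ : ℝ) : ℂ) * G ξ := by
      simp only [hK, hL]
      push_cast
      ring
    rw [h1]
    refine hb _ _ (abs_sub_le_iff.2 ⟨?_, ?_⟩)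
    · linarith [(lowPass n (k + 1)).le_one (x := ξ), (lowPass n k).nonneg (x := ξ)]
    · linarith [(lowPass n k).le_one (x := ξ), (lowPass n (k + 1)).nonneg (x := ξ)]
  have hlim : ∀ ξ, Filter.Tendsto (fun k => L k ξ) Filter.atTop (nhds (G ξ)) := by
    intro ξ
    refine tendsto_const_nhds.congr' ?_
    filter_upwards [(tendsto_pow_atTop_atTop_of_one_lt (one_lt_two (α := ℝ))).eventually_ge_atTop
      ‖ξ‖] with k hk
    simp [hL, lowPass_eq_one hk]
  set F := frostman μ α with hF
  set N := weightedNorm s' G with hN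
  set B : ℝ≥0∞ := (2 ^ (p - 1) * (1 + ENNReal.ofReal (8 * π) ^ p)) ^ (1/p) with hB
  set q := ENNReal.ofReal (2 ^ (1/p + s - s')) with hq
  have hlow : (∫⁻ x, waveSup (L 0) x ^ p ∂μ) ^ (1/p) ≤
      volume (Metric.ball (0 : E n) 2) ^ (1/2 : ℝ) * F ^ (1/p) * N := by
    have h1 : ∀ x, waveSup (L 0) x ≤ volume (Metric.ball (0 : E n) 2) ^ (1/2 : ℝ) * N := fun x =>
      (waveSup_le_lintegral _ x).trans (lintegral_enorm_le_of_support hs'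
        G.continuous.measurable (hLle 0) fun ξ hξ => by
          simp [hL, lowPass_eq_zero (k := 0) (ξ := ξ) (by simpa using hξ)])
    calc (∫⁻ x, waveSup (L 0) x ^ p ∂μ) ^ (1/p)
        ≤ (∫⁻ _, (volume (Metric.ball (0 : E n) 2) ^ (1/2 : ℝ) * N) ^ p ∂μ) ^ (1/p) := by
          gcongr with x
          exact h1 x
      _ ≤ ((volume (Metric.ball (0 : E n) 2) ^ (1/2 : ℝ) * N) ^ p * F) ^ (1/p) := by
          rw [lintegral_const]
          gcongr
          exact measure_univ_le_frostman hμ α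
      _ = _ := by
          rw [ENNReal.mul_rpow_of_nonneg _ _ (by positivity), ← ENNReal.rpow_mul,
            mul_one_div_cancel hp0.ne', ENNReal.rpow_one]
          ring
  have hpiece : ∀ k, (∫⁻ x, waveSup (K k) x ^ p ∂μ) ^ (1/p) ≤
      B * ENNReal.ofReal C * F ^ (1/p) * N * q ^ k := by
    intro k
    have h1 := lintegral_waveSup_rpow_le hp hC H hs (r := 2 ^ k) (one_le_pow₀ one_le_two)
      (K := K k) G.continuous.measurable
      (by simpa only [sub_eq_add_neg] using! (hLc (k + 1)).add (hLc k).neg)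
      ((hLd (k + 1)).sub (hLd k)) (hKle k)
      (fun ξ hξ => by
        simp [hK, hL, lowPass_eq_one hξ.le, lowPass_eq_one (k := k + 1) (ξ := ξ)
          (hξ.le.trans (pow_le_pow_right₀ one_le_two k.le_succ))])
      (fun ξ hξ => by
        have h2 : (2:ℝ) ^ (k + 1 + 1) ≤ ‖ξ‖ := by rw [pow_succ, pow_succ]; linarith
        simp [hK, hL, lowPass_eq_zero h2, lowPass_eq_zero (k := k) (ξ := ξ)
          ((pow_le_pow_right₀ one_le_two (k + 1).le_succ).trans h2)])
      μ hμ hα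
    rwa [← Real.rpow_natCast, ← Real.rpow_mul zero_le_two, mul_comm (k : ℝ),
      Real.rpow_mul zero_le_two, Real.rpow_natCast, ENNReal.ofReal_pow (by positivity)] at h1
  calc (∫⁻ x, waveSup G x ^ p ∂μ) ^ (1/p)
      ≤ (∫⁻ x, (waveSup (L 0) x + ∑' k, waveSup (K k) x) ^ p ∂μ) ^ (1/p) := by
        gcongr with x
        exact waveSup_le_add_tsum G.integrable hLi hLle hlim x
    _ ≤ (∫⁻ x, waveSup (L 0) x ^ p ∂μ) ^ (1/p) +
          (∫⁻ x, (∑' k, waveSup (K k) x) ^ p ∂μ) ^ (1/p) :=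
        ENNReal.lintegral_Lp_add_le (measurable_waveSup (hLi 0)).aemeasurable
          (Measurable.tsum fun k => measurable_waveSup (hKi k)).aemeasurable hp
    _ ≤ volume (Metric.ball (0 : E n) 2) ^ (1/2 : ℝ) * F ^ (1/p) * N +
          ∑' k, B * ENNReal.ofReal C * F ^ (1/p) * N * q ^ k :=
        add_le_add hlow ((ENNReal.lintegral_Lp_tsum_le hp fun k => measurable_waveSup (hKi k)).trans
          (ENNReal.tsum_le_tsum hpiece))
    _ = _ := by
        rw [ENNReal.tsum_mul_left, ENNReal.tsum_geometric]
        ring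

theorem integral_iSup_norm_halfWave_rpow {n : ℕ} (f : SchwartzMap (E n) ℂ) {p : ℝ}
    (hp : 0 < p) (μ : Measure (E n)) [IsFiniteMeasure μ] :
    ∫ x, (⨆ t : Set.Icc (0:ℝ) 1, ‖halfWave (⇑f) t x‖ ^ p) ∂μ =
      (∫⁻ x, waveSup (FT (⇑f)) x ^ p ∂μ).toReal := by
  have hi : Integrable (FT (⇑f)) := by
    rw [FT_eq_fourier]
    exact SchwartzMap.integrable _
  have hlt : ∀ x, waveSup (FT (⇑f)) x ^ p < ⊤ := fun x =>
    ENNReal.rpow_lt_top_of_nonneg hp.le (ne_top_of_le_ne_top hi.2.ne (waveSup_le_lintegral _ x))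
  rw [← integral_toReal ((measurable_waveSup hi).pow_const p).aemeasurable (.of_forall hlt)]
  refine integral_congr_ae (.of_forall fun x => ?_)
  dsimp only
  rw [waveSup, ENNReal.iSup_rpow_eq _ hp, ENNReal.toReal_iSup
    fun t => (ENNReal.rpow_lt_top_of_nonneg hp.le enorm_ne_top).ne]
  refine iSup_congr fun t => ?_
  rw [← ENNReal.toReal_rpow, toReal_enorm]
  rfl

/-- a Strichartz estimate for the half-wave propagator with respect to fractal
measures implies the corresponding maximal estimate with a loss of `1/p` derivatives. -/
theorem maximal_from_strichartz (n : ℕ) (hn : 1 ≤ n) (p s α C : ℝ)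
    (hp : 1 ≤ p) (hs : 0 ≤ s) (hα₀ : 0 < α) (hα₁ : α ≤ n) (hC : 0 < C)
    (H : ∀ (f : SchwartzMap (E n) ℂ) (μ : Measure (E n)), IsFiniteMeasure μ →
      μ (Metric.ball (0 : E n) 1)ᶜ = 0 → frostman μ α < ⊤ →
      (∫ t in (0:ℝ)..1, ∫ x, ‖halfWave (⇑f) t x‖ ^ p ∂μ) ^ (1/p) ≤
        C * (frostman μ α).toReal ^ (1/p) * sobolevNorm (⇑f) s) :
    ∀ s' : ℝ, s + 1/p < s' → ∃ C' : ℝ, 0 < C' ∧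
      ∀ (f : SchwartzMap (E n) ℂ) (μ : Measure (E n)), IsFiniteMeasure μ →
        μ (Metric.ball (0 : E n) 1)ᶜ = 0 → frostman μ α < ⊤ →
        (∫ x, (⨆ t : Set.Icc (0:ℝ) 1, ‖halfWave (⇑f) t x‖ ^ p) ∂μ) ^ (1/p) ≤
          C' * (frostman μ α).toReal ^ (1/p) * sobolevNorm (⇑f) s' := by
  intro s' hs'
  have hp0 : 0 < p := one_pos.trans_le hp
  have hpinv : 0 < 1 / p := by positivity
  set D : ℝ≥0∞ := volume (Metric.ball (0 : E n) 2) ^ (1/2 : ℝ) +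
    (2 ^ (p - 1) * (1 + ENNReal.ofReal (8 * π) ^ p)) ^ (1/p) * ENNReal.ofReal C *
      (1 - ENNReal.ofReal (2 ^ (1/p + s - s')))⁻¹ with hD
  have hDtop : D ≠ ⊤ := by
    have hq : ENNReal.ofReal (2 ^ (1/p + s - s')) < 1 := by
      rw [ENNReal.ofReal_lt_one]
      exact Real.rpow_lt_one_of_one_lt_of_neg one_lt_two (by linarith)
    have h1 : (1 - ENNReal.ofReal (2 ^ (1/p + s - s')))⁻¹ ≠ ⊤ :=
      ENNReal.inv_ne_top.2 (tsub_pos_of_lt hq).ne'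
    have h2 : (2:ℝ≥0∞) ^ (p - 1) ≠ ⊤ :=
      ENNReal.rpow_ne_top_of_nonneg (by linarith) (by simp)
    have h3 : ENNReal.ofReal (8 * π) ^ p ≠ ⊤ :=
      ENNReal.rpow_ne_top_of_nonneg hp0.le ENNReal.ofReal_ne_top
    have h4 : volume (Metric.ball (0 : E n) 2) ≠ ⊤ := measure_ball_lt_top.ne
    refine ENNReal.add_ne_top.2 ⟨ENNReal.rpow_ne_top_of_nonneg (by norm_num) h4, ?_⟩
    refine ENNReal.mul_ne_top (ENNReal.mul_ne_top ?_ ENNReal.ofReal_ne_top) h1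
    exact ENNReal.rpow_ne_top_of_nonneg hpinv.le
      (ENNReal.mul_ne_top h2 (ENNReal.add_ne_top.2 ⟨ENNReal.one_ne_top, h3⟩))
  refine ⟨D.toReal + 1, by positivity, fun f μ _ hμ hα => ?_⟩
  have hS : 0 ≤ sobolevNorm (⇑f) s' :=
    Real.rpow_nonneg (integral_nonneg fun ξ => by positivity) _
  have key := lintegral_waveSup_schwartz_rpow_le hp hC H (by linarith) (by linarith)
    (FourierTransform.fourier f) μ hμ hα (s' := s')
  rw [← FT_eq_fourier, ← ofReal_sobolevNorm, ← hD] at key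
  have hfin : D * frostman μ α ^ (1/p) * ENNReal.ofReal (sobolevNorm (⇑f) s') ≠ ⊤ :=
    ENNReal.mul_ne_top (ENNReal.mul_ne_top hDtop
      (ENNReal.rpow_ne_top_of_nonneg hpinv.le hα.ne)) ENNReal.ofReal_ne_top
  have h := ENNReal.toReal_mono hfin key
  rw [ENNReal.toReal_mul, ENNReal.toReal_mul, ENNReal.toReal_ofReal hS, ← ENNReal.toReal_rpow,
    ← ENNReal.toReal_rpow] at h
  rw [integral_iSup_norm_halfWave_rpow f hp0 μ]
  refine h.trans ?_
  gcongr
  linarith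
end
end

section
/- Let n ≥ 2, 1 ≤ p ≤ 2, 1 < α < n and s ≥ 0. Suppose there is a constant C > 0 such that for every Schwartz function f on ℝⁿ and every finite Borel measure μ on ℝⁿ supported in B(0,1) with [μ]_α < ∞ one has (∫_{ℝⁿ} sup_{t ∈ [0,1]} |e^{it√(−Δ)}f(x)|^p dμ(x))^{1/p} ≤ C [μ]_α^{1/p} ‖f‖_{H^s}. Then s ≥ max{(n−α)/2, (n+2−α)/4}. -/
open MeasureTheory Real Metric
open scoped ENNReal RealInnerProductSpace

noncomputable section

theorem exists_schwartz_FT_eq {n : ℕ} (g : E n → ℝ) (hg : ContDiff ℝ (⊤ : ℕ∞) g)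
    (hc : HasCompactSupport g) :
    ∃ f : SchwartzMap (E n) ℂ, ∀ ξ, FT (⇑f) ξ = (g ξ : ℂ) := by
  have hg' : ContDiff ℝ (⊤ : ℕ∞) (fun ξ => (g ξ : ℂ)) := Complex.ofRealCLM.contDiff.comp hg
  have hc' : HasCompactSupport (fun ξ => (g ξ : ℂ)) := hc.comp_left (g := fun x : ℝ => (x : ℂ)) rfl
  let G : SchwartzMap (E n) ℂ := hc'.toSchwartzMap hg'
  refine ⟨FourierTransform.fourierInv G, fun ξ => ?_⟩
  have h := congrArg (fun F : SchwartzMap (E n) ℂ => F ξ)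
    (FourierTransform.fourier_fourierInv_eq (F := SchwartzMap (E n) ℂ) G)
  simp only [SchwartzMap.fourier_coe] at h
  rw [Real.fourier_eq'] at h
  simpa [FT, G] using h

theorem continuous_halfWave {n : ℕ} (f : E n → ℂ) (g : E n → ℝ) (hg : Continuous g)
    (hc : HasCompactSupport g) (hf : ∀ ξ, FT f ξ = (g ξ : ℂ)) (t : ℝ) :
    Continuous (halfWave f t) := by
  unfold halfWave
  simp only [hf]
  refine continuous_of_dominated (bound := fun ξ => ‖g ξ‖) (fun x => ?_) (fun x => ?_)
    (hg.integrable_of_hasCompactSupport hc).norm ?_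
  · exact Continuous.aestronglyMeasurable (by fun_prop)
  · refine Filter.Eventually.of_forall fun ξ => ?_
    rw [norm_mul, Complex.norm_exp_ofReal_mul_I, one_mul, Complex.norm_real]
  · exact Filter.Eventually.of_forall fun ξ => by fun_prop

theorem norm_halfWave_le {n : ℕ} (f : E n → ℂ) (g : E n → ℝ) (hg : ∀ ξ, 0 ≤ g ξ)
    (hf : ∀ ξ, FT f ξ = (g ξ : ℂ)) (t : ℝ) (x : E n) :
    ‖halfWave f t x‖ ≤ ∫ ξ, g ξ := by
  unfold halfWave
  refine (norm_integral_le_integral_norm _).trans (le_of_eq ?_)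
  refine integral_congr_ae (Filter.Eventually.of_forall fun ξ => ?_)
  simp only [norm_mul, Complex.norm_exp_ofReal_mul_I, one_mul, hf, Complex.norm_real,
    Real.norm_of_nonneg (hg ξ)]

theorem half_le_cos_two_pi_mul {θ : ℝ} (k : ℤ) (h : |θ - k| ≤ 1 / 6) :
    1 / 2 ≤ Real.cos (2 * π * θ) := by
  have h1 : Real.cos (2 * π * θ) = Real.cos (|2 * π * (θ - k)|) := by
    rw [Real.cos_abs, ← Real.cos_sub_int_mul_two_pi _ k]
    congr 1
    ring
  rw [h1, ← Real.cos_pi_div_three, abs_mul, abs_of_pos Real.two_pi_pos]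
  have := Real.pi_pos
  exact Real.cos_le_cos_of_nonneg_of_le_pi (by positivity) (by linarith)
    (by nlinarith)

theorem half_integral_le_norm_halfWave {n : ℕ} (f : E n → ℂ) (g : E n → ℝ) (hg : Continuous g)
    (hc : HasCompactSupport g) (hg0 : ∀ ξ, 0 ≤ g ξ) (hf : ∀ ξ, FT f ξ = (g ξ : ℂ))
    (t : ℝ) (x : E n)
    (hphase : ∀ ξ, g ξ ≠ 0 → ∃ k : ℤ, |⟪x, ξ⟫ + t * ‖ξ‖ - k| ≤ 1 / 6) :
    1 / 2 * ∫ ξ, g ξ ≤ ‖halfWave f t x‖ := by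
  have hgi : Integrable g := hg.integrable_of_hasCompactSupport hc
  have hint : Integrable (fun ξ : E n =>
      Complex.exp (((2 * π * (⟪x, ξ⟫ + t * ‖ξ‖) : ℝ) : ℂ) * Complex.I) * (g ξ : ℂ)) := by
    refine Continuous.integrable_of_hasCompactSupport (by fun_prop) ?_
    exact HasCompactSupport.mul_left (hc.comp_left (g := fun x : ℝ => (x : ℂ)) rfl)
  have hre : (halfWave f t x).re = ∫ ξ, Real.cos (2 * π * (⟪x, ξ⟫ + t * ‖ξ‖)) * g ξ := by
    unfold halfWave
    simp only [hf]
    have := integral_re hint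
    simp only [RCLike.re_eq_complex_re] at this
    rw [← this]
    congr 1
    ext ξ
    rw [Complex.re_mul_ofReal, Complex.exp_ofReal_mul_I_re]
  refine le_trans ?_ (Complex.re_le_norm _)
  rw [hre, ← integral_const_mul]
  refine integral_mono (hgi.const_mul _) ?_ fun ξ => ?_
  · exact Continuous.integrable_of_hasCompactSupport (by fun_prop) hc.mul_left
  · by_cases h : g ξ = 0
    · simp [h]
    · obtain ⟨k, hk⟩ := hphase ξ h
      exact mul_le_mul_of_nonneg_right (half_le_cos_two_pi_mul k hk) (hg0 ξ)

theorem sobolevNorm_le {n : ℕ} (f : E n → ℂ) (g : E n → ℝ) (hg : Continuous g)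
    (hc : HasCompactSupport g) (hg0 : ∀ ξ, 0 ≤ g ξ) (hg1 : ∀ ξ, g ξ ≤ 1)
    (hf : ∀ ξ, FT f ξ = (g ξ : ℂ)) {s : ℝ} (hs : 0 ≤ s) {R : ℝ} (hR : 1 ≤ R)
    (hsupp : ∀ ξ, g ξ ≠ 0 → ‖ξ‖ ≤ R) :
    sobolevNorm f s ≤ ((2 * R ^ 2) ^ s * ∫ ξ, g ξ) ^ (1 / 2 : ℝ) := by
  unfold sobolevNorm
  refine Real.rpow_le_rpow (integral_nonneg fun ξ => by positivity) ?_ (by norm_num)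
  rw [← integral_const_mul]
  refine integral_mono_of_nonneg (Filter.Eventually.of_forall fun ξ => by positivity)
    ((hg.integrable_of_hasCompactSupport hc).const_mul _)
    (Filter.Eventually.of_forall fun ξ => ?_)
  simp only [hf, Complex.norm_real, Real.norm_of_nonneg (hg0 ξ)]
  by_cases h : g ξ = 0
  · simp [h]
  · have h1 := hsupp ξ h
    have h2 : 1 + ‖ξ‖ ^ 2 ≤ 2 * R ^ 2 := by nlinarith [norm_nonneg ξ]
    have h3 : g ξ ^ 2 ≤ g ξ := by nlinarith [hg0 ξ, hg1 ξ]
    exact mul_le_mul (Real.rpow_le_rpow (by positivity) h2 hs) h3 (by positivity) (by positivity)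

theorem integral_le_of_maximal_estimate {n : ℕ} {p α s C : ℝ} (hp : 1 ≤ p) (hs : 0 ≤ s)
    (hC : 0 < C)
    (H : ∀ (f : SchwartzMap (E n) ℂ) (μ : Measure (E n)), IsFiniteMeasure μ →
        μ (Metric.ball (0 : E n) 1)ᶜ = 0 → frostman μ α < ⊤ →
        (∫ x, (⨆ t : Set.Icc (0:ℝ) 1, ‖halfWave (⇑f) t x‖ ^ p) ∂μ) ^ (1/p) ≤
          C * (frostman μ α).toReal ^ (1/p) * sobolevNorm (⇑f) s)
    (g : E n → ℝ) (hg : ContDiff ℝ (⊤ : ℕ∞) g) (hc : HasCompactSupport g)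
    (hg0 : ∀ ξ, 0 ≤ g ξ) (hg1 : ∀ ξ, g ξ ≤ 1) {R : ℝ} (hR : 1 ≤ R)
    (hsupp : ∀ ξ, g ξ ≠ 0 → ‖ξ‖ ≤ R)
    (μ : Measure (E n)) [IsFiniteMeasure μ] (hμ : μ (Metric.ball (0 : E n) 1)ᶜ = 0)
    {B : ℝ} (hB : 0 ≤ B) (hfr : frostman μ α ≤ ENNReal.ofReal B)
    (hphase : ∀ᵐ x ∂μ, ∃ t ∈ Set.Icc (0 : ℝ) 1, ∀ ξ, g ξ ≠ 0 →
      ∃ k : ℤ, |⟪x, ξ⟫ + t * ‖ξ‖ - k| ≤ 1 / 6) :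
    (μ.real Set.univ) ^ (1 / p) * (1 / 2 * ∫ ξ, g ξ) ≤
      C * B ^ (1 / p) * ((2 * R ^ 2) ^ s * ∫ ξ, g ξ) ^ (1 / 2 : ℝ) := by
  have hp0 : 0 < p := by linarith
  obtain ⟨f, hf⟩ := exists_schwartz_FT_eq g hg hc
  have hI : 0 ≤ ∫ ξ, g ξ := integral_nonneg hg0
  have hmain := H f μ inferInstance hμ (hfr.trans_lt ENNReal.ofReal_lt_top)
  have hbd : ∀ x, BddAbove (Set.range fun t : Set.Icc (0:ℝ) 1 => ‖halfWave (⇑f) t x‖ ^ p) := by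
    intro x
    refine ⟨(∫ ξ, g ξ) ^ p, ?_⟩
    rintro _ ⟨t, rfl⟩
    exact Real.rpow_le_rpow (norm_nonneg _) (norm_halfWave_le f g hg0 hf t x) hp0.le
  have hmeas : Measurable fun x => ⨆ t : Set.Icc (0:ℝ) 1, ‖halfWave (⇑f) t x‖ ^ p := by
    refine LowerSemicontinuous.measurable (lowerSemicontinuous_ciSup hbd fun t => ?_)
    refine Continuous.lowerSemicontinuous ?_
    exact (continuous_halfWave f g hg.continuous hc hf t).norm.rpow_const
      fun _ => Or.inr hp0.le
  have hint : Integrable (fun x => ⨆ t : Set.Icc (0:ℝ) 1, ‖halfWave (⇑f) t x‖ ^ p) μ := by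
    refine Integrable.of_bound hmeas.aestronglyMeasurable ((∫ ξ, g ξ) ^ p)
      (Filter.Eventually.of_forall fun x => ?_)
    rw [Real.norm_of_nonneg (Real.iSup_nonneg fun t => by positivity)]
    exact ciSup_le fun t =>
      Real.rpow_le_rpow (norm_nonneg _) (norm_halfWave_le f g hg0 hf t x) hp0.le
  have hlow : μ.real Set.univ * (1 / 2 * ∫ ξ, g ξ) ^ p ≤
      ∫ x, (⨆ t : Set.Icc (0:ℝ) 1, ‖halfWave (⇑f) t x‖ ^ p) ∂μ := by
    rw [← smul_eq_mul, ← integral_const]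
    refine integral_mono_ae (integrable_const _) hint ?_
    filter_upwards [hphase] with x ⟨t, ht, hx⟩
    refine le_trans ?_ (le_ciSup (hbd x) ⟨t, ht⟩)
    exact Real.rpow_le_rpow (by positivity)
      (half_integral_le_norm_halfWave f g hg.continuous hc hg0 hf t x hx) hp0.le
  calc (μ.real Set.univ) ^ (1 / p) * (1 / 2 * ∫ ξ, g ξ)
      = (μ.real Set.univ * (1 / 2 * ∫ ξ, g ξ) ^ p) ^ (1 / p) := by
        rw [Real.mul_rpow (by positivity) (by positivity), ← Real.rpow_mul (by positivity),
          mul_one_div_cancel hp0.ne', Real.rpow_one]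
    _ ≤ _ := Real.rpow_le_rpow (by positivity) hlow (by positivity)
    _ ≤ _ := hmain
    _ ≤ _ := by
        have h1 : (frostman μ α).toReal ≤ B := ENNReal.toReal_le_of_le_ofReal hB hfr
        have h2 := sobolevNorm_le f g hg.continuous hc hg0 hg1 hf hs hR hsupp
        have h3 : 0 ≤ sobolevNorm (⇑f) s :=
          Real.rpow_nonneg (integral_nonneg fun ξ => by positivity) _
        gcongr


theorem frostman_map_pi_le {d : ℕ} (ν : Fin d → Measure ℝ) [∀ i, IsFiniteMeasure (ν i)]
    (β B : Fin d → ℝ) (hB : ∀ i, 0 ≤ B i)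
    (h : ∀ i x r, 0 < r → ν i (Set.Ioo (x - r) (x + r)) ≤ ENNReal.ofReal (B i * r ^ β i)) :
    frostman ((Measure.pi ν).map (WithLp.toLp 2 : (Fin d → ℝ) → E d)) (∑ i, β i) ≤
      ENNReal.ofReal (∏ i, B i) := by
  refine iSup_le fun x => iSup_le fun r => iSup_le fun hr => ?_
  refine ENNReal.div_le_of_le_mul ?_
  rw [Measure.map_apply (WithLp.measurable_toLp 2 _) measurableSet_ball]
  have hsub : (WithLp.toLp 2 : (Fin d → ℝ) → E d) ⁻¹' ball x r ⊆
      Set.pi Set.univ fun i => Set.Ioo (x i - r) (x i + r) := by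
    intro y hy i _
    have h1 : ‖(WithLp.toLp 2 y - x) i‖ ≤ ‖WithLp.toLp 2 y - x‖ := PiLp.norm_apply_le _ i
    have h2 : ‖WithLp.toLp 2 y - x‖ < r := by simpa [dist_eq_norm] using hy
    have h3 := abs_lt.1 (show |y i - x i| < r from h1.trans_lt h2)
    exact ⟨by linarith [h3.1], by linarith [h3.2]⟩
  refine (measure_mono hsub).trans ?_
  rw [Measure.pi_pi, ← ENNReal.ofReal_mul (Finset.prod_nonneg fun i _ => hB i),
    Real.rpow_sum_of_pos hr, ← Finset.prod_mul_distrib,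
    ENNReal.ofReal_prod_of_nonneg fun i _ => mul_nonneg (hB i) (by positivity)]
  exact Finset.prod_le_prod' fun i _ => h i (x i) r hr

/-- The normalised Lebesgue measure on `N` intervals of length `δ` with spacing `c / N`. -/
def comb (N : ℕ) (c δ : ℝ) : Measure ℝ :=
  ∑ k ∈ Finset.range N, ENNReal.ofReal (1 / (N * δ)) •
    volume.restrict (Set.Icc (k * (c / N)) (k * (c / N) + δ))

instance (N : ℕ) (c δ : ℝ) : IsFiniteMeasure (comb N c δ) := by
  refine ⟨?_⟩
  simp only [comb, Measure.coe_finsetSum, Finset.sum_apply, Measure.smul_apply, smul_eq_mul,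
    Measure.restrict_apply_univ, Real.volume_Icc]
  exact ENNReal.sum_lt_top.2 fun k _ => ENNReal.mul_lt_top ENNReal.ofReal_lt_top
    ENNReal.ofReal_lt_top

theorem comb_univ {N : ℕ} (hN : 1 ≤ N) (c : ℝ) {δ : ℝ} (hδ : 0 < δ) :
    comb N c δ Set.univ = 1 := by
  have hN0 : (0 : ℝ) < N := by exact_mod_cast hN
  simp only [comb, Measure.coe_finsetSum, Finset.sum_apply, Measure.smul_apply, smul_eq_mul,
    Measure.restrict_apply_univ, Real.volume_Icc, add_sub_cancel_left, Finset.sum_const,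
    Finset.card_range, nsmul_eq_mul]
  rw [← ENNReal.ofReal_mul (by positivity), ← ENNReal.ofReal_natCast,
    ← ENNReal.ofReal_mul (by positivity)]
  rw [show (N : ℝ) * (1 / (N * δ) * δ) = 1 by field_simp]
  simp

theorem ae_comb (N : ℕ) (c δ : ℝ) :
    ∀ᵐ x ∂(comb N c δ), ∃ k < N, x ∈ Set.Icc (k * (c / N)) (k * (c / N) + δ) := by
  simp only [comb, ae_iff, Measure.coe_finsetSum, Finset.sum_apply, Measure.smul_apply,
    smul_eq_mul]
  refine Finset.sum_eq_zero fun k hk => ?_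
  refine mul_eq_zero_of_right _ ?_
  rw [← ae_iff]
  filter_upwards [ae_restrict_mem measurableSet_Icc] with x hx
  exact ⟨k, Finset.mem_range.1 hk, hx⟩

theorem card_filter_mul_mem_Ioo_le (N : ℕ) {d a b : ℝ} (hd : 0 < d) (hab : a ≤ b) :
    (((Finset.range N).filter fun k : ℕ => a < k * d ∧ k * d < b).card : ℝ) ≤ (b - a) / d + 1 := by
  have h1 : ((Finset.range N).filter fun k : ℕ => a < k * d ∧ k * d < b).card ≤
      (Finset.Ioc ⌊a / d⌋ ⌊b / d⌋).card := by
    refine Finset.card_le_card_of_injOn (fun k : ℕ => (k : ℤ)) ?_ fun _ _ _ _ h => Int.ofNat.inj h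
    intro k hk
    simp only [Finset.coe_filter, Set.mem_ofPred_eq] at hk
    simp only [Finset.coe_Ioc, Set.mem_Ioc]
    refine ⟨Int.floor_lt.2 ?_, Int.le_floor.2 ?_⟩
    · rw [div_lt_iff₀ hd]; exact_mod_cast hk.2.1
    · rw [le_div_iff₀ hd]; exact_mod_cast hk.2.2.le
  rw [Int.card_Ioc] at h1
  have h2 : (((⌊b / d⌋ - ⌊a / d⌋).toNat : ℕ) : ℝ) ≤ (b - a) / d + 1 := by
    have h3 : (((⌊b / d⌋ - ⌊a / d⌋).toNat : ℤ)) = ⌊b / d⌋ - ⌊a / d⌋ := by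
      apply Int.toNat_of_nonneg
      have := Int.floor_le_floor (div_le_div_of_nonneg_right hab hd.le)
      omega
    have h4 : (((⌊b / d⌋ - ⌊a / d⌋).toNat : ℕ) : ℝ) = ⌊b / d⌋ - ⌊a / d⌋ := by exact_mod_cast h3
    rw [h4, sub_div]
    linarith [Int.floor_le (b / d), Int.lt_floor_add_one (a / d)]
  exact le_trans (by exact_mod_cast h1) h2

theorem comb_Ioo_le {N : ℕ} (hN : 1 ≤ N) {c δ : ℝ} (hc : 0 < c) (hδ : 0 < δ) (x : ℝ) {r : ℝ}
    (hr : 0 < r) :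
    comb N c δ (Set.Ioo (x - r) (x + r)) ≤
      ENNReal.ofReal (((2 * r + δ) / (c / N) + 1) * (1 / (N * δ) * min (2 * r) δ)) := by
  have hN0 : (0 : ℝ) < N := by exact_mod_cast hN
  simp only [comb, Measure.coe_finsetSum, Finset.sum_apply, Measure.smul_apply, smul_eq_mul]
  set S := (Finset.range N).filter
    fun k : ℕ => x - r - δ < k * (c / N) ∧ k * (c / N) < x + r
  have hm : 0 ≤ 1 / (N * δ) * min (2 * r) δ := by positivity
  calc _ ≤ ∑ k ∈ Finset.range N, if (x - r - δ < k * (c / N) ∧ k * (c / N) < x + r) then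
          ENNReal.ofReal (1 / (N * δ) * min (2 * r) δ) else 0 := by
        refine Finset.sum_le_sum fun k _ => ?_
        rw [Measure.restrict_apply measurableSet_Ioo]
        split_ifs with h
        · rw [ENNReal.ofReal_mul (by positivity)]
          gcongr
          rcases le_total (2 * r) δ with h' | h'
          · rw [min_eq_left h']
            refine (measure_mono Set.inter_subset_left).trans ?_
            rw [Real.volume_Ioo]
            exact ENNReal.ofReal_le_ofReal (by linarith)
          · rw [min_eq_right h']
            refine (measure_mono Set.inter_subset_right).trans ?_
            rw [Real.volume_Icc]
            exact ENNReal.ofReal_le_ofReal (by linarith)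
        · rw [show Set.Ioo (x - r) (x + r) ∩
              Set.Icc (k * (c / N)) (k * (c / N) + δ) = ∅ from ?_]
          · simp
          · ext y
            simp only [Set.mem_inter_iff, Set.mem_Ioo, Set.mem_Icc, Set.mem_empty_iff_false,
              iff_false]
            rintro ⟨⟨h1, h2⟩, h3, h4⟩
            exact h ⟨by linarith, by linarith⟩
    _ = ENNReal.ofReal (S.card * (1 / (N * δ) * min (2 * r) δ)) := by
        rw [← Finset.sum_filter, Finset.sum_const, nsmul_eq_mul,
          ENNReal.ofReal_mul (Nat.cast_nonneg S.card), ENNReal.ofReal_natCast]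
    _ ≤ _ := by
        refine ENNReal.ofReal_le_ofReal (mul_le_mul_of_nonneg_right ?_ hm)
        have := card_filter_mul_mem_Ioo_le N (d := c / N) (a := x - r - δ) (b := x + r)
          (by positivity) (by linarith)
        rwa [show x + r - (x - r - δ) = 2 * r + δ by ring] at this

theorem comb_Ioo_le_rpow {N : ℕ} (hN : 1 ≤ N) {c δ β : ℝ} (hc : 0 < c) (hδ : 0 < δ)
    (hβ0 : 0 ≤ β) (hβ1 : β ≤ 1) (hNδ : 1 / (N : ℝ) ≤ 2 * δ ^ β) (hδN : δ ≤ c / N)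
    (x : ℝ) {r : ℝ} (hr : 0 < r) :
    comb N c δ (Set.Ioo (x - r) (x + r)) ≤ ENNReal.ofReal ((16 + 3 / c) * r ^ β) := by
  have hN0 : (0 : ℝ) < N := by exact_mod_cast hN
  have hrβ : 0 < r ^ β := by positivity
  have hc3 : 0 < 3 / c := by positivity
  rcases le_total r δ with h | h
  · refine (comb_Ioo_le hN hc hδ x hr).trans (ENNReal.ofReal_le_ofReal ?_)
    have h1 : (2 * r + δ) / (c / N) + 1 ≤ 4 := by
      have : (2 * r + δ) / (c / N) ≤ 3 := by
        rw [div_le_iff₀ (by positivity)]; linarith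
      linarith
    have h2 : 1 / (N * δ) * min (2 * r) δ ≤ 4 * r ^ β := by
      have h3 : δ ^ β / δ * r ≤ r ^ β := by
        rw [div_mul_eq_mul_div, div_le_iff₀ hδ]
        have h4 : δ = δ ^ β * δ ^ (1 - β) := by rw [← Real.rpow_add hδ]; simp
        have h5 : r = r ^ β * r ^ (1 - β) := by rw [← Real.rpow_add hr]; simp
        have h6 : r ^ (1 - β) ≤ δ ^ (1 - β) := Real.rpow_le_rpow hr.le h (by linarith)
        calc δ ^ β * r = δ ^ β * (r ^ β * r ^ (1 - β)) := by rw [← h5]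
          _ ≤ δ ^ β * (r ^ β * δ ^ (1 - β)) := by gcongr
          _ = r ^ β * (δ ^ β * δ ^ (1 - β)) := by ring
          _ = r ^ β * δ := by rw [← h4]
      calc 1 / (N * δ) * min (2 * r) δ ≤ 1 / (N * δ) * (2 * r) := by gcongr; exact min_le_left _ _
        _ = 2 * (1 / N * (r / δ)) := by field_simp
        _ ≤ 2 * ((2 * δ ^ β) * (r / δ)) := by gcongr
        _ = 4 * (δ ^ β / δ * r) := by field_simp; ring
        _ ≤ _ := by gcongr
    calc _ ≤ 4 * (4 * r ^ β) := mul_le_mul h1 h2 (by positivity) (by norm_num)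
      _ ≤ _ := by nlinarith
  · rcases le_total r 1 with h' | h'
    · refine (comb_Ioo_le hN hc hδ x hr).trans (ENNReal.ofReal_le_ofReal ?_)
      have h1 : r ≤ r ^ β := by
        simpa using Real.rpow_le_rpow_of_exponent_ge hr h' hβ1
      have h2 : δ ^ β ≤ r ^ β := Real.rpow_le_rpow hδ.le h hβ0
      calc _ ≤ ((2 * r + r) / (c / N) + 1) * (1 / (N * δ) * δ) := by
            gcongr; exact min_le_right _ _
        _ = 3 / c * r + 1 / N := by field_simp; ring
        _ ≤ 3 / c * r ^ β + 2 * r ^ β := by gcongr; linarith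
        _ ≤ _ := by nlinarith
    · refine (measure_mono (Set.subset_univ _)).trans ?_
      rw [comb_univ hN c hδ, ENNReal.one_le_ofReal]
      have := Real.one_le_rpow h' hβ0
      nlinarith

theorem exists_bump_sum (d : ℕ) : ∃ V : ℝ, 0 < V ∧ ∀ (ι : Type) (J : Finset ι) (v : ι → E d),
    (∀ a ∈ J, ∀ b ∈ J, a ≠ b → 1 ≤ ‖v a - v b‖) →
    ∃ g : E d → ℝ, ContDiff ℝ (⊤ : ℕ∞) g ∧ HasCompactSupport g ∧ (∀ ξ, 0 ≤ g ξ) ∧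
      (∀ ξ, g ξ ≤ 1) ∧ (∀ ξ, g ξ ≠ 0 → ∃ a ∈ J, ‖ξ - v a‖ ≤ 1 / 16) ∧
      ∫ ξ, g ξ = J.card * V := by
  let χ : ContDiffBump (0 : E d) := ⟨1 / 32, 1 / 16, by norm_num, by norm_num⟩
  have hχ : ∀ ξ : E d, χ ξ ≠ 0 → ‖ξ‖ < 1 / 16 := by
    intro ξ h
    have : ξ ∈ Function.support χ := h
    rw [χ.support_eq] at this
    exact mem_ball_zero_iff.1 this
  refine ⟨∫ ξ, χ ξ, χ.integral_pos, fun ι J v hsep => ⟨fun ξ => ∑ a ∈ J, χ (ξ - v a),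
    ?_, ?_, ?_, ?_, ?_, ?_⟩⟩
  · exact ContDiff.sum fun a _ => χ.contDiff.comp (contDiff_id.sub contDiff_const)
  · classical
    induction J using Finset.induction_on with
    | empty => simp only [Finset.sum_empty]; exact HasCompactSupport.zero
    | insert a J ha ih =>
      simp only [Finset.sum_insert ha]
      refine HasCompactSupport.add ?_ (ih fun a ha b hb => hsep a (Finset.mem_insert_of_mem ha) b
        (Finset.mem_insert_of_mem hb))
      exact χ.hasCompactSupport.comp_homeomorph (Homeomorph.subRight (v a))
  · exact fun ξ => Finset.sum_nonneg fun a _ => χ.nonneg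
  · intro ξ
    beta_reduce
    by_cases h : ∃ a ∈ J, χ (ξ - v a) ≠ 0
    · obtain ⟨a, ha, hne⟩ := h
      rw [Finset.sum_eq_single_of_mem a ha]
      · exact χ.le_one
      · intro b hb hba
        by_contra hb0
        have h1 := hχ _ hne
        have h2 := hχ _ hb0
        have h3 := hsep b hb a ha hba
        have h4 : ‖v b - v a‖ ≤ ‖ξ - v a‖ + ‖ξ - v b‖ := by
          rw [show v b - v a = (ξ - v a) - (ξ - v b) by abel]
          exact norm_sub_le _ _
        linarith
    · push Not at h
      rw [Finset.sum_eq_zero h]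
      exact zero_le_one
  · intro ξ hξ
    obtain ⟨a, ha, hne⟩ := Finset.exists_ne_zero_of_sum_ne_zero hξ
    exact ⟨a, ha, (hχ _ hne).le⟩
  · rw [integral_finsetSum]
    · simp [integral_sub_right_eq_self (fun ξ => χ ξ)]
    · intro a _
      exact χ.integrable.comp_sub_right (v a)

/-- The frequency lattice of the test functions. -/
def latticePoint {m : ℕ} (a T : ℝ) (j : Fin (m + 1) → ℕ) : E (m + 1) :=
  WithLp.toLp 2 (Fin.cons (a + j 0) fun i => T * j i.succ)

@[simp]
theorem latticePoint_zero {m : ℕ} (a T : ℝ) (j : Fin (m + 1) → ℕ) :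
    latticePoint a T j 0 = a + j 0 := rfl

@[simp]
theorem latticePoint_succ {m : ℕ} (a T : ℝ) (j : Fin (m + 1) → ℕ) (i : Fin m) :
    latticePoint a T j i.succ = T * j i.succ := rfl

theorem one_le_norm_latticePoint_sub {m : ℕ} (a : ℝ) {T : ℝ} (hT : 1 ≤ T)
    {j k : Fin (m + 1) → ℕ} (hjk : j ≠ k) :
    1 ≤ ‖latticePoint a T j - latticePoint a T k‖ := by
  obtain ⟨i, hi⟩ := Function.ne_iff.1 hjk
  have h1 : (1 : ℝ) ≤ |(j i : ℝ) - k i| := by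
    have : (1 : ℤ) ≤ |(j i : ℤ) - k i| := Int.one_le_abs (by omega)
    exact_mod_cast this
  refine le_trans ?_ (PiLp.norm_apply_le _ i)
  rw [Real.norm_eq_abs, PiLp.sub_apply]
  refine Fin.cases (motive := fun i => 1 ≤ |(j i : ℝ) - k i| →
    1 ≤ |latticePoint a T j i - latticePoint a T k i|) ?_ (fun i h => ?_) i h1
  · intro h
    simpa using h
  · rw [latticePoint_succ, latticePoint_succ, ← mul_sub, abs_mul, abs_of_nonneg (by linarith)]
    nlinarith

theorem abs_mul_sub_natCast_le {N K k j : ℕ} {c x ξ : ℝ} (hN : 1 ≤ N) (hK : 1 ≤ K) (hc : 0 < c)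
    (hδ : 1 / (K : ℝ) ≤ c / N) (hk : k < N)
    (hx : x ∈ Set.Icc (k * (c / N)) (k * (c / N) + 1 / K))
    (hj : N / c * j ≤ c * K) (hξ : |ξ - N / c * j| ≤ 1 / 16) :
    |x * ξ - (k * j : ℕ)| ≤ c + c / 16 ∧ 0 ≤ x ∧ x ≤ c := by
  have hN0 : (0 : ℝ) < N := by exact_mod_cast hN
  have hK0 : (0 : ℝ) < K := by exact_mod_cast hK
  have hx0 : 0 ≤ x := le_trans (by positivity) hx.1
  have hxc : x ≤ c := by
    have h1 : (k : ℝ) + 1 ≤ N := by exact_mod_cast hk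
    calc x ≤ k * (c / N) + 1 / K := hx.2
      _ ≤ (k + 1) * (c / N) := by linarith
      _ ≤ N * (c / N) := by gcongr
      _ = c := by field_simp
  refine ⟨?_, hx0, hxc⟩
  have h2 : x * ξ - (k * j : ℕ) =
      (x - k * (c / N)) * (N / c * j) + x * (ξ - N / c * j) := by
    push_cast
    field_simp
    ring
  rw [h2]
  refine (abs_add_le _ _).trans (add_le_add ?_ ?_)
  · rw [abs_of_nonneg (mul_nonneg (by linarith [hx.1]) (by positivity))]
    calc _ ≤ 1 / (K : ℝ) * (c * K) :=
          mul_le_mul (by linarith [hx.2]) hj (by positivity) (by positivity)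
      _ = c := by field_simp
  · rw [abs_mul, abs_of_nonneg hx0]
    calc x * _ ≤ c * (1 / 16) := by gcongr
      _ = _ := by ring

theorem mul_le_of_mul_le_rpow_half {k D X I : ℝ} (hk : 0 < k) (hI : 0 < I)
    (hX : 0 ≤ X) (h : k * I ≤ D * (X * I) ^ (1 / 2 : ℝ)) : I ≤ D ^ 2 / k ^ 2 * X := by
  rw [← Real.sqrt_eq_rpow] at h
  have h1 : (k * I) ^ 2 ≤ (D * √(X * I)) ^ 2 := pow_le_pow_left₀ (by positivity) h 2
  rw [mul_pow, mul_pow, Real.sq_sqrt (by positivity)] at h1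
  have h2 : k ^ 2 * I ≤ D ^ 2 * X := by
    refine le_of_mul_le_mul_right ?_ hI
    linarith
  rw [div_mul_eq_mul_div, le_div_iff₀ (by positivity)]
  linarith

/-- The one-dimensional factors of `combProd`. -/
def combFamily (m N : ℕ) (c δ : ℝ) : Fin (m + 1) → Measure ℝ :=
  Fin.cons (volume.restrict (Set.Icc (-c) 0)) fun _ => comb N c δ

instance (m N : ℕ) (c δ : ℝ) (i : Fin (m + 1)) : IsFiniteMeasure (combFamily m N c δ i) := by
  refine Fin.cases ?_ (fun i => ?_) i
  · exact inferInstanceAs (IsFiniteMeasure (volume.restrict (Set.Icc (-c) 0)))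
  · exact inferInstanceAs (IsFiniteMeasure (comb N c δ))

/-- The fractal measure: Lebesgue measure on a segment times combs in the other variables. -/
def combProd (m N : ℕ) (c δ : ℝ) : Measure (E (m + 1)) :=
  (Measure.pi (combFamily m N c δ)).map (WithLp.toLp 2)

instance (m N : ℕ) (c δ : ℝ) : IsFiniteMeasure (combProd m N c δ) := by
  unfold combProd; infer_instance

theorem combProd_real_univ {m N : ℕ} (hN : 1 ≤ N) {c δ : ℝ} (hc : 0 ≤ c) (hδ : 0 < δ) :
    (combProd m N c δ).real Set.univ = c := by
  rw [Measure.real, combProd, Measure.map_apply (WithLp.measurable_toLp 2 _) MeasurableSet.univ,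
    Set.preimage_univ, Measure.pi_univ, Fin.prod_univ_succ]
  simp [combFamily, comb_univ hN c hδ, hc]

theorem ae_combProd (m N : ℕ) (c δ : ℝ) :
    ∀ᵐ x ∂(combProd m N c δ), x 0 ∈ Set.Icc (-c) 0 ∧
      ∀ i : Fin m, ∃ k < N, x i.succ ∈ Set.Icc (k * (c / N)) (k * (c / N) + δ) := by
  have h : ∀ i, ∀ᵐ y ∂(Measure.pi (combFamily m N c δ)), Fin.cases (motive := fun _ => Prop)
      (y 0 ∈ Set.Icc (-c) 0)
      (fun i => ∃ k < N, y i.succ ∈ Set.Icc (k * (c / N)) (k * (c / N) + δ)) i := by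
    intro i
    refine Fin.cases ?_ (fun i => ?_) i
    · exact (Measure.tendsto_eval_ae_ae (μ := combFamily m N c δ) (i := 0)).eventually
        (ae_restrict_mem measurableSet_Icc)
    · exact (Measure.tendsto_eval_ae_ae (μ := combFamily m N c δ) (i := i.succ)).eventually
        (ae_comb N c δ)
  refine ((MeasurableEquiv.toLp 2 (Fin (m + 1) → ℝ)).measurableEmbedding.ae_map_iff).2 ?_
  filter_upwards [ae_all_iff.2 h] with y hy
  exact ⟨hy 0, fun i => hy i.succ⟩

theorem frostman_combProd_le {m N : ℕ} (hN : 1 ≤ N) {c δ β : ℝ} (hc : 0 < c) (hδ : 0 < δ)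
    (hβ0 : 0 ≤ β) (hβ1 : β ≤ 1) (hNδ : 1 / (N : ℝ) ≤ 2 * δ ^ β) (hδN : δ ≤ c / N) :
    frostman (combProd m N c δ) (1 + m * β) ≤ ENNReal.ofReal (2 * (16 + 3 / c) ^ m) := by
  have hc3 : 0 < 3 / c := by positivity
  have := frostman_map_pi_le (combFamily m N c δ) (Fin.cons 1 fun _ => β)
    (Fin.cons 2 fun _ => 16 + 3 / c) (fun i => ?_) (fun i x r hr => ?_)
  · simpa [combProd, Fin.sum_univ_succ, Fin.prod_univ_succ] using this
  · refine Fin.cases ?_ (fun i => ?_) i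
    · simp
    · simp only [Fin.cons_succ]; positivity
  · refine Fin.cases ?_ (fun i => ?_) i
    · simp only [combFamily, Fin.cons_zero, Real.rpow_one]
      refine (Measure.restrict_apply_le _ _).trans ?_
      rw [Real.volume_Ioo]
      exact ENNReal.ofReal_le_ofReal (by linarith)
    · simpa [combFamily] using comb_Ioo_le_rpow hN hc hδ hβ0 hβ1 hNδ hδN x hr

theorem lattice_phase {m N K : ℕ} {a c t : ℝ} (hN : 1 ≤ N) (hK : 1 ≤ K) (hc : 0 < c)
    (hmc : m * (c + c / 16) ≤ 1 / 12) (hδ : 1 / (K : ℝ) ≤ c / N) {x ξ : E (m + 1)}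
    {j : Fin (m + 1) → ℕ}
    (hx : ∀ i : Fin m, ∃ k < N, x i.succ ∈ Set.Icc (k * (c / N)) (k * (c / N) + 1 / K))
    (hj : ∀ i : Fin m, N / c * j i.succ ≤ c * K)
    (hξ : ‖ξ - latticePoint a (N / c) j‖ ≤ 1 / 16) (h0 : |x 0 * ξ 0 + t * ‖ξ‖| ≤ 1 / 16) :
    ∃ k : ℤ, |⟪x, ξ⟫ + t * ‖ξ‖ - k| ≤ 1 / 6 := by
  choose k hkN hk using hx
  refine ⟨∑ i, ((k i * j i.succ : ℕ) : ℤ), ?_⟩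
  have h1 : ⟪x, ξ⟫ + t * ‖ξ‖ - ((∑ i, ((k i * j i.succ : ℕ) : ℤ) : ℤ) : ℝ) =
      (x 0 * ξ 0 + t * ‖ξ‖) + ∑ i : Fin m, (x i.succ * ξ i.succ - (k i * j i.succ : ℕ)) := by
    rw [Finset.sum_sub_distrib, PiLp.inner_apply, Fin.sum_univ_succ]
    simp only [RCLike.inner_apply, conj_trivial]
    push_cast
    simp only [mul_comm]
    ring
  rw [h1]
  have h2 : ∀ i : Fin m, |x i.succ * ξ i.succ - (k i * j i.succ : ℕ)| ≤ c + c / 16 := fun i => by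
    refine (abs_mul_sub_natCast_le hN hK hc hδ (hkN i) (hk i) (hj i) ?_).1
    have := (PiLp.norm_apply_le (ξ - latticePoint a (N / c) j) i.succ).trans hξ
    simpa using this
  calc _ ≤ |x 0 * ξ 0 + t * ‖ξ‖| + ∑ i : Fin m, |x i.succ * ξ i.succ - (k i * j i.succ : ℕ)| :=
        (abs_add_le _ _).trans (by gcongr; exact Finset.abs_sum_le_sum_abs _ _)
    _ ≤ 1 / 16 + ∑ _i : Fin m, (c + c / 16) := by gcongr with i; exact h2 i
    _ ≤ 1 / 6 := by
        simp only [Finset.sum_const, Finset.card_univ, Fintype.card_fin, nsmul_eq_mul]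
        linarith

theorem norm_lt_one_of_abs_le {m : ℕ} {c : ℝ} (hmc : (m + 1) * c ^ 2 < 1)
    {x : E (m + 1)} (hx : ∀ i, |x i| ≤ c) : ‖x‖ < 1 := by
  have h : ‖x‖ ^ 2 < 1 := by
    rw [EuclideanSpace.norm_sq_eq]
    calc ∑ i, ‖x i‖ ^ 2 ≤ ∑ _i : Fin (m + 1), c ^ 2 :=
          Finset.sum_le_sum fun i _ => pow_le_pow_left₀ (norm_nonneg _) (hx i) 2
      _ < 1 := by simpa using hmc
  nlinarith [norm_nonneg x]

set_option maxHeartbeats 1000000 in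
/-- The consequence of the maximal estimate for lattice-type data, from which both necessary
conditions follow by choosing the frequency box and the time function. -/
theorem lattice_bound_of_maximal_estimate {m : ℕ} (hm : 1 ≤ m) {p α s C : ℝ} (hp : 1 ≤ p)
    (hs : 0 ≤ s) (hα₁ : 1 < α) (hα₂ : α < (m : ℝ) + 1) (hC : 0 < C)
    (H : ∀ (f : SchwartzMap (E (m + 1)) ℂ) (μ : Measure (E (m + 1))), IsFiniteMeasure μ →
        μ (Metric.ball (0 : E (m + 1)) 1)ᶜ = 0 → frostman μ α < ⊤ →
        (∫ x, (⨆ t : Set.Icc (0:ℝ) 1, ‖halfWave (⇑f) t x‖ ^ p) ∂μ) ^ (1/p) ≤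
          C * (frostman μ α).toReal ^ (1/p) * sobolevNorm (⇑f) s)
    {c : ℝ} (hc : 0 < c) (hmc : 32 * (m + 1) * c ≤ 1) :
    ∃ A : ℝ, 0 < A ∧ ∀ᶠ K : ℕ in Filter.atTop, ∀ (a R : ℝ) (L : ℕ) (τ : ℝ → ℝ), 1 ≤ R →
      1 ≤ L → (∀ y ∈ Set.Icc (-c) 0, τ y ∈ Set.Icc (0 : ℝ) 1) →
      (∀ ξ : E (m + 1), ξ 0 ∈ Set.Icc (a - 1 / 16) (a + L) → (∀ i : Fin m, |ξ i.succ| ≤ K) →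
        ‖ξ‖ ≤ R ∧ ∀ y ∈ Set.Icc (-c) 0, |y * ξ 0 + τ y * ‖ξ‖| ≤ 1 / 16) →
      L * (K : ℝ) ^ ((m : ℝ) + 1 - α) ≤ A * R ^ (2 * s) := by
  obtain ⟨V, hV, hbump⟩ := exists_bump_sum (m + 1)
  have hm0 : (0 : ℝ) < m := by exact_mod_cast hm
  have hm1 : (1 : ℝ) ≤ m := by exact_mod_cast hm
  set β : ℝ := (α - 1) / m with hβ
  have hβ0 : 0 < β := div_pos (by linarith) hm0
  have hβ1 : β < 1 := by rw [hβ, div_lt_one hm0]; linarith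
  have hmβ : 1 + m * β = α := by rw [hβ]; field_simp; ring
  have hc1 : c ≤ 1 / 64 := by nlinarith
  set B : ℝ := 2 * (16 + 3 / c) ^ m with hB
  have hB0 : 0 < B := by positivity
  set D := (C * B ^ (1 / p)) ^ 2 / (c ^ (1 / p) * (1 / 2)) ^ 2 with hD
  have hD0 : 0 < D := by positivity
  refine ⟨D * 2 ^ s / (c ^ (2 * m) * V), by positivity, ?_⟩
  have hlim : Filter.Tendsto (fun K : ℕ => (K : ℝ) ^ (β - 1)) Filter.atTop (nhds 0) := by
    have := (tendsto_rpow_neg_atTop (y := 1 - β) (by linarith)).comp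
      (tendsto_natCast_atTop_atTop (R := ℝ))
    simpa [Function.comp_def] using this
  filter_upwards [hlim.eventually (eventually_le_nhds hc), Filter.eventually_ge_atTop 1]
    with K hKc hK a R L τ hR hL hτ hbox
  have hK0 : (0 : ℝ) < K := by exact_mod_cast hK
  have hK1 : (1 : ℝ) ≤ K := by exact_mod_cast hK
  set N : ℕ := ⌊(K : ℝ) ^ β⌋₊ with hN
  have hKβ : 1 ≤ (K : ℝ) ^ β := Real.one_le_rpow hK1 hβ0.le
  have hN1 : 1 ≤ N := Nat.le_floor (by simpa using hKβ)
  have hN1' : (1 : ℝ) ≤ N := by exact_mod_cast hN1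
  have hN0 : (0 : ℝ) < N := by linarith
  have hNle : (N : ℝ) ≤ (K : ℝ) ^ β := Nat.floor_le (by positivity)
  have hNge : (K : ℝ) ^ β ≤ 2 * N := by
    have := Nat.lt_floor_add_one ((K : ℝ) ^ β)
    rw [← hN] at this
    linarith
  have hδ0 : (0 : ℝ) < 1 / K := by positivity
  have hNδ : 1 / (N : ℝ) ≤ 2 * (1 / (K : ℝ)) ^ β := by
    rw [Real.div_rpow zero_le_one hK0.le, Real.one_rpow, mul_one_div,
      div_le_div_iff₀ hN0 (by positivity)]
    linarith
  have hδN : 1 / (K : ℝ) ≤ c / N := by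
    rw [div_le_div_iff₀ hK0 hN0, one_mul]
    rw [Real.rpow_sub_one hK0.ne', div_le_iff₀ hK0] at hKc
    linarith
  have hT : 1 ≤ (N : ℝ) / c := by rw [le_div_iff₀ hc]; linarith
  have hT0 : 0 < (N : ℝ) / c := by positivity
  set M : ℕ := ⌊c * K / (N / c)⌋₊ + 1 with hM
  have hMlow : c ^ 2 * (K : ℝ) ^ (1 - β) ≤ M := by
    calc c ^ 2 * (K : ℝ) ^ (1 - β) = c ^ 2 * (K / (K : ℝ) ^ β) := by
          rw [Real.rpow_sub hK0, Real.rpow_one]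
      _ ≤ c ^ 2 * (K / N) := by gcongr
      _ = c * K / (N / c) := by field_simp
      _ ≤ M := by rw [hM]; push_cast; exact (Nat.lt_floor_add_one _).le
  set J : Finset (Fin (m + 1) → ℕ) := Fintype.piFinset
    (Fin.cons (Finset.range L) fun _ => Finset.range M) with hJ
  have hJ0 : ∀ j ∈ J, j 0 < L := fun j hj => by
    simpa using Fintype.mem_piFinset.1 hj 0
  have hJs : ∀ j ∈ J, ∀ i : Fin m, (N : ℝ) / c * j i.succ ≤ c * K := fun j hj i => by
    have h1 : j i.succ < M := by simpa using Fintype.mem_piFinset.1 hj i.succ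
    have h2 : j i.succ ≤ ⌊c * K / (N / c)⌋₊ := Nat.lt_succ_iff.1 h1
    have h3 : (j i.succ : ℝ) ≤ c * K / (N / c) := (Nat.le_floor_iff (by positivity)).1 h2
    rwa [le_div_iff₀ hT0, mul_comm] at h3
  have hJcard : (J.card : ℝ) = L * (M : ℝ) ^ m := by
    rw [hJ, Fintype.card_piFinset, Fin.prod_univ_succ]
    simp
  obtain ⟨g, hg, hgc, hg0, hg1, hgs, hgi⟩ := hbump _ J (latticePoint a (N / c))
    fun j _ k _ hjk => one_le_norm_latticePoint_sub a hT hjk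
  have hsupp : ∀ ξ, g ξ ≠ 0 → ξ 0 ∈ Set.Icc (a - 1 / 16) (a + L) ∧
      ∀ i : Fin m, |ξ i.succ| ≤ K := by
    intro ξ hξ
    obtain ⟨j, hj, hjξ⟩ := hgs ξ hξ
    have hcoord : ∀ i, |ξ i - latticePoint a (N / c) j i| ≤ 1 / 16 := fun i =>
      (PiLp.norm_apply_le (ξ - latticePoint a (N / c) j) i).trans hjξ
    constructor
    · have h1 := abs_le.1 (hcoord 0)
      have h2 : (j 0 : ℝ) + 1 ≤ L := by exact_mod_cast hJ0 j hj
      have h3 : (0 : ℝ) ≤ j 0 := Nat.cast_nonneg _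
      rw [latticePoint_zero] at h1
      exact ⟨by linarith [h1.1], by linarith [h1.2]⟩
    · intro i
      have h1 := abs_le.1 (hcoord i.succ)
      have h2 := hJs j hj i
      have h3 : 0 ≤ (N : ℝ) / c * j i.succ := by positivity
      rw [latticePoint_succ] at h1
      have h4 : c * K ≤ 1 / 64 * K := by gcongr
      rw [abs_le]
      constructor <;> linarith [h1.1, h1.2]
  have hae := ae_combProd m N c (1 / K)
  have hkey := integral_le_of_maximal_estimate hp hs hC H g hg hgc hg0 hg1 hR
    (fun ξ hξ => (hbox ξ (hsupp ξ hξ).1 (hsupp ξ hξ).2).1) (combProd m N c (1 / K)) ?_ hB0.le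
    (hmβ ▸ frostman_combProd_le hN1 hc hδ0 hβ0.le hβ1.le hNδ hδN) ?_
  · rw [combProd_real_univ hN1 hc.le hδ0, ← mul_assoc] at hkey
    have hLpos : (0 : ℝ) < L := by exact_mod_cast hL
    have hMpos : (0 : ℝ) < M := by rw [hM]; positivity
    have hIpos : 0 < ∫ ξ, g ξ := by rw [hgi, hJcard]; positivity
    have h1 := mul_le_of_mul_le_rpow_half (by positivity) hIpos (by positivity) hkey
    rw [← hD, hgi, hJcard, Real.mul_rpow (by norm_num) (by positivity), ← Real.rpow_natCast R 2,
      ← Real.rpow_mul (by linarith)] at h1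
    have h2 : c ^ (2 * m) * (K : ℝ) ^ ((m : ℝ) + 1 - α) ≤ (M : ℝ) ^ m := by
      calc c ^ (2 * m) * (K : ℝ) ^ ((m : ℝ) + 1 - α) = (c ^ 2 * (K : ℝ) ^ (1 - β)) ^ m := by
            rw [mul_pow, ← pow_mul, ← Real.rpow_natCast ((K : ℝ) ^ (1 - β)) m,
              ← Real.rpow_mul hK0.le, ← hmβ]
            congr 2
            ring
        _ ≤ _ := pow_le_pow_left₀ (by positivity) hMlow m
    rw [div_mul_eq_mul_div, le_div_iff₀ (by positivity)]
    calc L * (K : ℝ) ^ ((m : ℝ) + 1 - α) * (c ^ (2 * m) * V)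
        = L * (c ^ (2 * m) * (K : ℝ) ^ ((m : ℝ) + 1 - α)) * V := by ring
      _ ≤ L * (M : ℝ) ^ m * V := by gcongr
      _ ≤ _ := h1
      _ = _ := by push_cast; ring
  · refine mem_ae_iff.1 ?_
    filter_upwards [hae] with x ⟨hx0, hx⟩
    refine mem_ball_zero_iff.2 (norm_lt_one_of_abs_le (c := c) (by nlinarith) fun i => ?_)
    refine Fin.cases ?_ (fun i => ?_) i
    · exact abs_le.2 ⟨hx0.1, by linarith [hx0.2]⟩
    · obtain ⟨k, hk, hxk⟩ := hx i
      obtain ⟨-, h1, h2⟩ := abs_mul_sub_natCast_le (j := 0) (ξ := 0) hN1 hK hc hδN hk hxk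
        (by simp; positivity) (by norm_num)
      rwa [abs_of_nonneg h1]
  · filter_upwards [hae] with x ⟨hx0, hx⟩
    refine ⟨τ (x 0), hτ _ hx0, fun ξ hξ => ?_⟩
    obtain ⟨j, hj, hjξ⟩ := hgs ξ hξ
    exact lattice_phase hN1 hK hc (by nlinarith) hδN hx (hJs j hj) hjξ
      ((hbox ξ (hsupp ξ hξ).1 (hsupp ξ hξ).2).2 _ hx0)

theorem le_of_eventually_rpow_le {a b A : ℝ}
    (h : ∀ᶠ K : ℕ in Filter.atTop, (K : ℝ) ^ a ≤ A * (K : ℝ) ^ b) : a ≤ b := by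
  by_contra! hab
  have hlim : Filter.Tendsto (fun K : ℕ => (K : ℝ) ^ (a - b)) Filter.atTop Filter.atTop :=
    (tendsto_rpow_atTop (by linarith)).comp tendsto_natCast_atTop_atTop
  obtain ⟨K, hK, hKA, hK1⟩ := (h.and ((hlim.eventually_gt_atTop A).and
    (Filter.eventually_ge_atTop 1))).exists
  have hK0 : (0 : ℝ) < K := by exact_mod_cast hK1
  rw [Real.rpow_sub hK0, lt_div_iff₀ (by positivity)] at hKA
  linarith

theorem norm_sq_succ {m : ℕ} (ξ : E (m + 1)) :
    ‖ξ‖ ^ 2 = ξ 0 ^ 2 + ∑ i : Fin m, ξ i.succ ^ 2 := by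
  simp [EuclideanSpace.norm_sq_eq, Fin.sum_univ_succ]

theorem sum_sq_le_of_abs_le {m K : ℕ} {ξ : E (m + 1)} (h : ∀ i : Fin m, |ξ i.succ| ≤ K) :
    ∑ i : Fin m, ξ i.succ ^ 2 ≤ m * (K : ℝ) ^ 2 := by
  calc ∑ i : Fin m, ξ i.succ ^ 2 ≤ ∑ _i : Fin m, (K : ℝ) ^ 2 :=
        Finset.sum_le_sum fun i _ => by
          rw [← sq_abs]; exact pow_le_pow_left₀ (abs_nonneg _) (h i) 2
    _ = _ := by simp

/-- the condition `s ≥ max{(n-α)/2, (n+2-α)/4}` is necessary for the maximal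
estimate for the half-wave propagator with respect to fractal measures. -/
theorem necessary_condition_maximal (n : ℕ) (hn : 2 ≤ n) (p α s : ℝ)
    (hp₁ : 1 ≤ p) (hp₂ : p ≤ 2) (hα₁ : 1 < α) (hα₂ : α < n) (hs : 0 ≤ s)
    (H : ∃ C : ℝ, 0 < C ∧
      ∀ (f : SchwartzMap (E n) ℂ) (μ : Measure (E n)), IsFiniteMeasure μ →
        μ (Metric.ball (0 : E n) 1)ᶜ = 0 → frostman μ α < ⊤ →
        (∫ x, (⨆ t : Set.Icc (0:ℝ) 1, ‖halfWave (⇑f) t x‖ ^ p) ∂μ) ^ (1/p) ≤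
          C * (frostman μ α).toReal ^ (1/p) * sobolevNorm (⇑f) s) :
    max (((n : ℝ) - α) / 2) (((n : ℝ) + 2 - α) / 4) ≤ s := by
  obtain ⟨m, rfl⟩ : ∃ m, n = m + 1 := ⟨n - 1, by omega⟩
  obtain ⟨C, hC, H⟩ := H
  have hm : 1 ≤ m := by omega
  have hm1 : (1 : ℝ) ≤ m := by exact_mod_cast hm
  push_cast at hα₂ ⊢
  set c : ℝ := 1 / (32 * (m + 1)) with hc
  have hc0 : 0 < c := by positivity
  have hmc : 32 * ((m : ℝ) + 1) * c = 1 := by rw [hc]; field_simp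
  have hc1 : c ≤ 1 / 64 := by nlinarith
  obtain ⟨A, hA, hbound⟩ :=
    lattice_bound_of_maximal_estimate hm hp₁ hs hα₁ hα₂ hC H hc0 hmc.le
  have hfirst : (m : ℝ) + 1 - α ≤ 2 * s := by
    refine le_of_eventually_rpow_le (A := A * ((m : ℝ) + 1) ^ (2 * s)) ?_
    filter_upwards [hbound, Filter.eventually_ge_atTop 1] with K hKb hK
    have hK1 : (1 : ℝ) ≤ K := by exact_mod_cast hK
    have h := hKb 0 ((m + 1) * K) 1 (fun _ => 0) (by nlinarith) le_rfl (fun y _ => by simp) ?_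
    · rw [Real.mul_rpow (by positivity) (by positivity)] at h
      push_cast at h
      linarith
    · intro ξ hξ0 hξ
      have h0 : |ξ 0| ≤ 1 := abs_le.2 ⟨by linarith [hξ0.1], by simpa using hξ0.2⟩
      constructor
      · refine abs_le_of_sq_le_sq' ?_ (by positivity) |>.2
        have h1 := sum_sq_le_of_abs_le hξ
        have h2 : ξ 0 ^ 2 ≤ 1 := by rw [← sq_abs]; exact pow_le_one₀ (abs_nonneg _) h0
        rw [norm_sq_succ]
        have h3 : (1 : ℝ) ≤ (K : ℝ) ^ 2 := one_le_pow₀ hK1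
        nlinarith
      · intro y hy
        have hy' : |y| ≤ c := abs_le.2 ⟨hy.1, by linarith [hy.2]⟩
        rw [zero_mul, add_zero, abs_mul]
        nlinarith [abs_nonneg y, abs_nonneg (ξ 0)]
  have hsecond : (2 : ℝ) + ((m : ℝ) + 1 - α) ≤ 4 * s := by
    refine le_of_eventually_rpow_le (A := A * ((m : ℝ) + 2) ^ (2 * s)) ?_
    filter_upwards [hbound, Filter.eventually_ge_atTop 1] with K hKb hK
    have hK1 : (1 : ℝ) ≤ K := by exact_mod_cast hK
    have hK0 : (0 : ℝ) < K := by linarith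
    have hK2 : (1 : ℝ) ≤ (K : ℝ) ^ 2 := one_le_pow₀ hK1
    have h := hKb ((K : ℝ) ^ 2) ((m + 2) * (K : ℝ) ^ 2) (K ^ 2) (fun y => -y) (by nlinarith)
      (Nat.one_le_pow _ _ (by omega))
      (fun y hy => ⟨by linarith [hy.2], by linarith [hy.1]⟩) ?_
    · rw [Real.mul_rpow (by positivity) (by positivity)] at h
      push_cast at h
      rw [Real.rpow_add hK0, Real.rpow_two]
      refine h.trans (le_of_eq ?_)
      rw [← Real.rpow_natCast (K : ℝ) 2, ← Real.rpow_mul hK0.le, ← mul_assoc]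
      congr 2
      push_cast
      ring
    · intro ξ hξ0 hξ
      have hξl := hξ0.1
      have hξu : ξ 0 ≤ 2 * (K : ℝ) ^ 2 := by
        have := hξ0.2
        push_cast at this
        linarith
      have h1 := sum_sq_le_of_abs_le hξ
      have h1' : 0 ≤ ∑ i : Fin m, ξ i.succ ^ 2 := Finset.sum_nonneg fun i _ => sq_nonneg _
      have h2 := norm_sq_succ ξ
      have hξp : (K : ℝ) ^ 2 / 2 ≤ ξ 0 := by linarith
      have h3 : ξ 0 ≤ ‖ξ‖ := by
        refine abs_le_of_sq_le_sq' ?_ (norm_nonneg _) |>.2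
        linarith
      constructor
      · refine abs_le_of_sq_le_sq' ?_ (by positivity) |>.2
        rw [h2]
        have h4 : ξ 0 ^ 2 ≤ (2 * (K : ℝ) ^ 2) ^ 2 := pow_le_pow_left₀ (by linarith) hξu 2
        nlinarith [mul_le_mul_of_nonneg_left hK2 (show 0 ≤ (m : ℝ) * (K : ℝ) ^ 2 by positivity),
          sq_nonneg ((m : ℝ) * (K : ℝ) ^ 2), sq_nonneg ((K : ℝ) ^ 2)]
      · intro y hy
        have h5 : ‖ξ‖ - ξ 0 ≤ 2 * m := by
          have h6 : (‖ξ‖ - ξ 0) * (K : ℝ) ^ 2 ≤ (‖ξ‖ - ξ 0) * (‖ξ‖ + ξ 0) :=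
            mul_le_mul_of_nonneg_left (by linarith) (by linarith)
          have h7 : (‖ξ‖ - ξ 0) * (K : ℝ) ^ 2 ≤ m * (K : ℝ) ^ 2 := by
            refine h6.trans ?_
            linarith [show (‖ξ‖ - ξ 0) * (‖ξ‖ + ξ 0) = ‖ξ‖ ^ 2 - ξ 0 ^ 2 by ring]
          have h8 := le_of_mul_le_mul_right h7 (by positivity)
          linarith
        rw [show y * ξ 0 + -y * ‖ξ‖ = (-y) * (‖ξ‖ - ξ 0) by ring,
          abs_of_nonneg (mul_nonneg (by linarith [hy.2]) (by linarith))]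
        calc (-y) * (‖ξ‖ - ξ 0) ≤ c * (2 * m) :=
              mul_le_mul (by linarith [hy.1]) h5 (by linarith) hc0.le
          _ ≤ 1 / 16 := by nlinarith
  exact max_le (by linarith) (by linarith)
end
end
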